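/- Let g^Δ be a semicosimplicial DGLA over K and let A ∈ Art_K. Then the relation ∼ is an equivalence relation on Z¹_sc(exp g^Δ)(A), and Z¹_sc(exp g^Δ)(A) is closed under ∼: if (l₀,m₀) ∈ Z¹_sc(exp g^Δ)(A) and (l₁,m₁) ∈ (g_0¹ ⊕ g_1⁰)⊗m_A is related to (l₀,m₀) via elements a ∈ g_0⁰⊗m_A and b ∈ g_1^{−1}⊗m_A as in the definition of ∼, then (l₁,m₁) ∈ Z¹_sc(exp g^Δ)(A). -/

import Mathlib

open scoped TensorProduct Classical

noncomputable section

/-- The data of a (pre-)differential graded Lie algebra over `K`: a `K`-vector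
space together with degree projections `proj i` (giving the grading), a
differential `d` and a bilinear bracket `br`.  The axioms are collected in
`PreDGLA.IsDGLA` below. -/
structure PreDGLA (K : Type) [Field K] where
  carrier : Type
  [acg : AddCommGroup carrier]
  [mod : Module K carrier]
  proj : ℤ → (carrier →ₗ[K] carrier)
  d : carrier →ₗ[K] carrier
  br : carrier →ₗ[K] carrier →ₗ[K] carrier

attribute [instance] PreDGLA.acg PreDGLA.mod

namespace PreDGLA

variable {K : Type} [Field K]

/-- The degree `i` homogeneous component `L^i`. -/
def comp (L : PreDGLA K) (i : ℤ) : Submodule K L.carrier :=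
  LinearMap.ker (L.proj i - LinearMap.id)

/-- The sign `(-1)^i` as an integer. -/
def sgn (i : ℤ) : ℤ := ((Int.negOnePow i : ℤˣ) : ℤ)

/-- The axioms making a `PreDGLA` an honest differential graded Lie algebra:
the projections form a grading, `d` is a degree `1` differential, and the
bracket is graded (graded antisymmetry, graded Jacobi, graded Leibniz). -/
structure IsDGLA (L : PreDGLA K) : Prop where
  proj_idem : ∀ i x, L.proj i (L.proj i x) = L.proj i x
  proj_orth : ∀ i j x, i ≠ j → L.proj i (L.proj j x) = 0
  proj_finite : ∀ x, (Function.support fun i => L.proj i x).Finite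
  proj_total : ∀ x, (∑ᶠ i, L.proj i x) = x
  d_sq : ∀ x, L.d (L.d x) = 0
  d_deg : ∀ i, ∀ x ∈ L.comp i, L.d x ∈ L.comp (i + 1)
  br_deg : ∀ i j, ∀ x ∈ L.comp i, ∀ y ∈ L.comp j, L.br x y ∈ L.comp (i + j)
  antisymm : ∀ i j, ∀ x ∈ L.comp i, ∀ y ∈ L.comp j,
      L.br x y = -(sgn (i * j) • L.br y x)
  jacobi : ∀ i j, ∀ x ∈ L.comp i, ∀ y ∈ L.comp j, ∀ z,
      L.br x (L.br y z) = L.br (L.br x y) z + sgn (i * j) • L.br y (L.br x z)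
  leibniz : ∀ i, ∀ x ∈ L.comp i, ∀ y,
      L.d (L.br x y) = L.br (L.d x) y + sgn i • L.br x (L.d y)

/-- Morphisms of (pre-)DGLAs: linear maps commuting with differentials,
brackets and the grading. -/
structure Hom (L M : PreDGLA K) where
  lin : L.carrier →ₗ[K] M.carrier
  map_d : ∀ x, lin (L.d x) = M.d (lin x)
  map_br : ∀ x y, lin (L.br x y) = M.br (lin x) (lin y)
  map_proj : ∀ i x, lin (L.proj i x) = M.proj i (lin x)

/-- The Maurer-Cartan set: degree one elements satisfying
`d x + ½ [x,x] = 0`. -/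
def MCset (L : PreDGLA K) : Set L.carrier :=
  {x | x ∈ L.comp 1 ∧ L.d x + (2 : K)⁻¹ • L.br x x = 0}

/-- The gauge action `e^a * x = x + Σ_{n≥0} (ad_a)^n([a,x] - d a)/(n+1)!`. -/
def gauge (L : PreDGLA K) (a x : L.carrier) : L.carrier :=
  x + ∑ᶠ n : ℕ, ((((n + 1).factorial : K))⁻¹ •
    ((L.br a ^ n) (L.br a x - L.d a)))

/-- Right-nested Lie monomial on a list of elements. -/
def nb (L : PreDGLA K) : List L.carrier → L.carrier
  | [] => 0
  | [x] => x
  | x :: y :: xs => L.br x (nb L (y :: xs))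

/-- The word `a^{r_1} b^{s_1} ⋯ a^{r_{n+1}} b^{s_{n+1}}` appearing in Dynkin's
formula. -/
def dynkinWord (L : PreDGLA K) (a b : L.carrier) (n : ℕ)
    (rs : Fin (n + 1) → ℕ × ℕ) : List L.carrier :=
  (List.finRange (n + 1)).flatMap fun i =>
    List.replicate (rs i).1 a ++ List.replicate (rs i).2 b

/-- The coefficient in Dynkin's explicit formula for the
Baker-Campbell-Hausdorff series. -/
def dynkinCoeff (K : Type) [Field K] (n : ℕ) (rs : Fin (n + 1) → ℕ × ℕ) : K :=
  if ∀ i, 1 ≤ (rs i).1 + (rs i).2 then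
    ((-1 : K) ^ n / ((n : K) + 1)) *
      ((∑ i, ((rs i).1 + (rs i).2) : ℕ) : K)⁻¹ *
      ((∏ i, ((rs i).1.factorial * (rs i).2.factorial) : ℕ) : K)⁻¹
  else 0

/-- The Baker-Campbell-Hausdorff product `a • b = log(e^a e^b)`, via Dynkin's
explicit formula.  (In the nilpotent situations where it is used only finitely
many terms are non-zero.) -/
def bch (L : PreDGLA K) (a b : L.carrier) : L.carrier :=
  ∑ᶠ p : (Σ n : ℕ, Fin (n + 1) → ℕ × ℕ),
    dynkinCoeff K p.1 p.2 • L.nb (L.dynkinWord a b p.1 p.2)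

/-- The irrelevant stabilizer `Stab(x) = {d h + [x,h] : h ∈ L^{-1}}`. -/
def Stab (L : PreDGLA K) (x : L.carrier) : Set L.carrier :=
  {y | ∃ h ∈ L.comp (-1), y = L.d h + L.br x h}

/-- Gauge equivalence of two elements: `y = e^a * x` for some degree zero `a`. -/
def gaugeEquiv (L : PreDGLA K) (x y : L.carrier) : Prop :=
  ∃ a ∈ L.comp 0, L.gauge a x = y

/-- The deformation set: Maurer-Cartan elements modulo gauge equivalence. -/
def DefSpace (L : PreDGLA K) : Type :=
  Quot (fun x y : L.MCset => L.gaugeEquiv x.1 y.1)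

end PreDGLA

/-- A local Artinian `K`-algebra with residue field `K`. -/
structure ArtinData (K : Type) [Field K] where
  A : Type
  [cring : CommRing A]
  [alg : Algebra K A]
  [isLocal : IsLocalRing A]
  isArtinian : IsArtinianRing A
  residue_field : ∀ a : A, ∃ c : K, a - algebraMap K A c ∈ IsLocalRing.maximalIdeal A

attribute [instance] ArtinData.cring ArtinData.alg ArtinData.isLocal

namespace ArtinData

variable {K : Type} [Field K]

/-- The maximal ideal, as a `K`-submodule. -/
def mId (R : ArtinData K) : Submodule K R.A :=
  Submodule.restrictScalars K (IsLocalRing.maximalIdeal R.A)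

/-- Multiplication on the maximal ideal, as a `K`-bilinear map. -/
def mmul (R : ArtinData K) : R.mId →ₗ[K] R.mId →ₗ[K] R.mId where
  toFun a :=
    { toFun := fun b => ⟨a.1 * b.1, Ideal.mul_mem_left _ _ b.2⟩
      map_add' := by intro b c; ext; simp [mul_add]
      map_smul' := by intro k b; ext; simp [Algebra.mul_smul_comm] }
  map_add' := by intro a b; ext; simp [add_mul]
  map_smul' := by intro k a; ext; simp [Algebra.smul_mul_assoc]

end ArtinData

/-- Tensoring a DGLA with the maximal ideal of a local Artinian algebra:
`L ⊗ m_A`, with the induced grading, differential and bracket. -/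
def PreDGLA.tmA {K : Type} [Field K] (L : PreDGLA K) (R : ArtinData K) :
    PreDGLA K where
  carrier := L.carrier ⊗[K] R.mId
  proj := fun i => LinearMap.rTensor _ (L.proj i)
  d := LinearMap.rTensor _ L.d
  br := TensorProduct.curry
    ((TensorProduct.map (TensorProduct.lift L.br) (TensorProduct.lift R.mmul)).comp
      (TensorProduct.tensorTensorTensorComm K L.carrier R.mId L.carrier R.mId).toLinearMap)

/-- A morphism of Artinian base algebras. -/
structure ArtinHom {K : Type} [Field K] (R S : ArtinData K) where
  toAlg : R.A →ₐ[K] S.A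
  maps_m : ∀ x : R.A, x ∈ R.mId → toAlg x ∈ S.mId

namespace ArtinHom

variable {K : Type} [Field K] {R S : ArtinData K}

/-- The induced linear map on maximal ideals. -/
def mLin (f : ArtinHom R S) : R.mId →ₗ[K] S.mId where
  toFun x := ⟨f.toAlg x.1, f.maps_m x.1 x.2⟩
  map_add' := by intro a b; ext; simp
  map_smul' := by intro k a; ext; simp [Algebra.smul_def]

/-- The induced map `L ⊗ m_R → L ⊗ m_S`. -/
def tmap (f : ArtinHom R S) (L : PreDGLA K) :
    (L.tmA R).carrier →ₗ[K] (L.tmA S).carrier :=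
  LinearMap.lTensor L.carrier f.mLin

end ArtinHom

/-- A semicosimplicial DGLA: a diagram `g_0 ⇉ g_1 ⇶ g_2 ⋯` of DGLAs, where
`face n k : g_n → g_{n+1}` is the coface map `∂_{k,n+1}` (`k = 0, …, n+1`),
subject to the semicosimplicial identities. -/
structure ScDGLA (K : Type) [Field K] where
  g : ℕ → PreDGLA K
  isDGLA : ∀ n, (g n).IsDGLA
  face : ∀ n : ℕ, Fin (n + 2) → PreDGLA.Hom (g n) (g (n + 1))
  face_comm : ∀ (n : ℕ) (k l : Fin (n + 2)), (l : ℕ) ≤ (k : ℕ) → ∀ x,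
    (face (n + 1) k.succ).lin ((face n l).lin x) =
      (face (n + 1) l.castSucc).lin ((face n k).lin x)

namespace ScDGLA

variable {K : Type} [Field K]

/-- The tensored coface maps `∂_{k,n+1} ⊗ id : g_n ⊗ m_A → g_{n+1} ⊗ m_A`. -/
def faceT (G : ScDGLA K) (R : ArtinData K) (n : ℕ) (k : Fin (n + 2)) :
    ((G.g n).tmA R).carrier →ₗ[K] ((G.g (n + 1)).tmA R).carrier :=
  LinearMap.rTensor _ (G.face n k).lin

/-- The set `Z¹_sc(exp g^Δ)(A)` of semicosimplicial Maurer-Cartan data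
`(l, m)`: `l` is Maurer-Cartan in `g_0 ⊗ m_A`, `m ∈ g_1^0 ⊗ m_A` conjugates
the two pullbacks of `l`, and satisfies the cocycle condition up to homotopy
on `g_2`. -/
def Zsc (G : ScDGLA K) (R : ArtinData K) :
    Set (((G.g 0).tmA R).carrier × ((G.g 1).tmA R).carrier) :=
  {p | p.1 ∈ ((G.g 0).tmA R).MCset ∧ p.2 ∈ ((G.g 1).tmA R).comp 0 ∧
    G.faceT R 0 1 p.1 = ((G.g 1).tmA R).gauge p.2 (G.faceT R 0 0 p.1) ∧
    ∃ nn ∈ ((G.g 2).tmA R).comp (-1),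
      ((G.g 2).tmA R).bch (G.faceT R 1 0 p.2)
          (((G.g 2).tmA R).bch (-(G.faceT R 1 1 p.2)) (G.faceT R 1 2 p.2)) =
        ((G.g 2).tmA R).d nn +
          ((G.g 2).tmA R).br (G.faceT R 1 2 (G.faceT R 0 0 p.1)) nn}

/-- The equivalence relation `∼` on `Z¹_sc(exp g^Δ)(A)`. -/
def srel (G : ScDGLA K) (R : ArtinData K) :
    (((G.g 0).tmA R).carrier × ((G.g 1).tmA R).carrier) →
      (((G.g 0).tmA R).carrier × ((G.g 1).tmA R).carrier) → Prop :=
  fun p q =>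
    ∃ a ∈ ((G.g 0).tmA R).comp 0, ∃ b ∈ ((G.g 1).tmA R).comp (-1),
      ((G.g 0).tmA R).gauge a p.1 = q.1 ∧
      ((G.g 1).tmA R).bch (-p.2)
          (((G.g 1).tmA R).bch (-(G.faceT R 0 1 a))
            (((G.g 1).tmA R).bch q.2 (G.faceT R 0 0 a))) =
        ((G.g 1).tmA R).d b + ((G.g 1).tmA R).br (G.faceT R 0 0 p.1) b

/-- `H¹_sc(exp g^Δ)(A) = Z¹_sc(exp g^Δ)(A)/∼`. -/
def Hsc (G : ScDGLA K) (R : ArtinData K) : Type :=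
  Quot (fun x y : (G.Zsc R) => G.srel R x.1 y.1)

end ScDGLA

set_option linter.all false

section ExpLog
open Finset
variable (K : Type) [Field K] [CharZero K] {A : Type} [Ring A] [Algebra K A]

/-- exponential of nilpotent elements -/
def kexp (a : A) : A :=
  ∑ i ∈ range (nilpotencyClass a), ((i.factorial : K))⁻¹ • a ^ i

lemma kexp_eq_exp (a : A) :
    kexp K a = @IsNilpotent.exp A _ (Module.compHom A (algebraMap ℚ K)) a := by
  unfold kexp IsNilpotent.exp
  refine Finset.sum_congr rfl fun i _ => ?_
  change _ = (algebraMap ℚ K ((i.factorial : ℚ)⁻¹)) • a ^ i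
  simp

lemma kexp_eq_sum {a : A} {k : ℕ} (h : a ^ k = 0) :
    kexp K a = ∑ i ∈ range k, ((i.factorial : K))⁻¹ • a ^ i := by
  rw [kexp_eq_exp]
  let _ : Module ℚ A := Module.compHom A (algebraMap ℚ K)
  rw [IsNilpotent.exp_eq_sum h]
  refine Finset.sum_congr rfl fun i _ => ?_
  change (algebraMap ℚ K ((i.factorial : ℚ)⁻¹)) • a ^ i = _
  simp

lemma kexp_add {a b : A} (h : Commute a b) (ha : IsNilpotent a) (hb : IsNilpotent b) :
    kexp K (a + b) = kexp K a * kexp K b := by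
  simp only [kexp_eq_exp]
  let _ : Module ℚ A := Module.compHom A (algebraMap ℚ K)
  exact IsNilpotent.exp_add_of_commute h ha hb

lemma kexp_zero : kexp K (0 : A) = 1 := by
  simp [kexp_eq_sum K (pow_one (0 : A))]

lemma kexp_mul_neg {a : A} (h : IsNilpotent a) : kexp K a * kexp K (-a) = 1 := by
  rw [← kexp_add K (Commute.neg_right rfl) h h.neg]; simp [kexp_zero]

lemma kexp_neg_mul {a : A} (h : IsNilpotent a) : kexp K (-a) * kexp K a = 1 := by
  rw [← kexp_add K (Commute.neg_left rfl) h.neg h]; simp [kexp_zero]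

/-- `exp a = 1 + a * (unit)`-type statement: `exp a = 1` forces `a = 0`. -/
lemma eq_zero_of_kexp_eq_one {a : A} (h : IsNilpotent a) (h1 : kexp K a = 1) : a = 0 := by
  obtain ⟨n, hn⟩ := h
  induction n with
  | zero => rw [pow_zero] at hn; rw [← mul_one a, hn, mul_zero]
  | succ n ih =>
    rcases Nat.eq_zero_or_pos n with rfl | hpos
    · simpa using hn
    apply ih
    have h2 := kexp_eq_sum K (k := n + 1 + 1) (pow_eq_zero_of_le (Nat.le_succ _) hn)
    rw [h1, Finset.sum_range_succ', Finset.sum_range_succ'] at h2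
    have h3 : a ^ (n - 1) * (∑ i ∈ range n, ((i + 1 + 1).factorial : K)⁻¹ • a ^ (i + 1 + 1)) = 0 := by
      rw [Finset.mul_sum]
      refine Finset.sum_eq_zero fun i _ => ?_
      rw [mul_smul_comm, ← pow_add, pow_eq_zero_of_le (by omega) hn, smul_zero]
    have h4 := congrArg (fun z => a ^ (n - 1) * z) h2
    simp only [mul_add, h3] at h4
    simp at h4
    rwa [← pow_succ, Nat.sub_add_cancel hpos] at h4

/-- truncated logarithm `log (1 + u)` -/
def klog (N : ℕ) (u : A) : A :=
  ∑ k ∈ range N, (((-1 : K)) ^ k / ((k : K) + 1)) • u ^ (k + 1)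

open Polynomial in
lemma kexp_klog_poly (n : ℕ) : ∃ q : K[X],
    ∑ j ∈ range (n + 1), ((j.factorial : K))⁻¹ • (klog K (n + 1) (X : K[X])) ^ j
      = 1 + X + X ^ (n + 1) * q := by
  set l : K[X] := klog K (n + 1) X with hl
  set E : K[X] := ∑ j ∈ range (n + 1), ((j.factorial : K))⁻¹ • l ^ j with hE
  have hld : (1 + X) * derivative l = 1 - (-X) ^ (n + 1) := by
    have : derivative l = ∑ k ∈ range (n + 1), (-X : K[X]) ^ k := by
      rw [hl, klog, derivative_sum]
      refine Finset.sum_congr rfl fun k _ => ?_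
      have hk : (k : K) + 1 ≠ 0 := by exact_mod_cast Nat.succ_ne_zero k
      rw [derivative_smul, derivative_X_pow, smul_eq_C_mul, ← mul_assoc, ← C_mul]
      push_cast
      rw [div_mul_cancel₀ _ hk, neg_pow (X : K[X])]
      simp
    rw [this]
    have := mul_neg_geom_sum (-X : K[X]) (n + 1)
    rw [← this]; ring
  have hlX : ∃ r, l = X * r := by
    refine ⟨∑ k ∈ range (n + 1), (((-1 : K)) ^ k / ((k : K) + 1)) • X ^ k, ?_⟩
    rw [hl, klog, Finset.mul_sum]
    refine Finset.sum_congr rfl fun k _ => ?_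
    rw [mul_smul_comm, ← pow_succ']
  obtain ⟨r, hr⟩ := hlX
  have hEd : derivative E = (E - ((n.factorial : K))⁻¹ • l ^ n) * derivative l := by
    have h1 : E - ((n.factorial : K))⁻¹ • l ^ n
        = ∑ j ∈ range n, ((j.factorial : K))⁻¹ • l ^ j := by
      rw [hE, Finset.sum_range_succ]; ring
    rw [h1, hE, derivative_sum, Finset.sum_range_succ', Finset.sum_mul]
    simp only [derivative_smul, pow_zero, derivative_one, smul_zero, add_zero]
    refine Finset.sum_congr rfl fun j _ => ?_
    rw [derivative_pow, smul_eq_C_mul, smul_eq_C_mul, Nat.factorial_succ]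
    have hj : (j : K) + 1 ≠ 0 := by exact_mod_cast Nat.succ_ne_zero j
    have : C ((((j + 1) * j.factorial : ℕ) : K)⁻¹) * C ((j + 1 : ℕ) : K)
        = C ((j.factorial : K)⁻¹) := by
      rw [← C_mul]; congr 1; push_cast; rw [mul_inv]; field_simp
    rw [← this]; simp only [Nat.add_sub_cancel]; ring
  have key : ∃ s, (1 + X) * derivative E = E + X ^ n * s := by
    refine ⟨- ((n.factorial : K))⁻¹ • r ^ n
      - (E - ((n.factorial : K))⁻¹ • l ^ n) * ((-1) ^ (n + 1) * X), ?_⟩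
    rw [hEd, mul_left_comm, hld, hr]
    simp only [smul_eq_C_mul, neg_pow (X : K[X]), mul_pow]
    simp only [map_neg]
    ring
  obtain ⟨s, hs⟩ := key
  have hrec : ∀ k < n, E.coeff (k + 1) * (k + 1) + E.coeff k * k = E.coeff k := by
    intro k hk
    have := congrArg (fun p => p.coeff k) hs
    simp only [add_mul, one_mul, coeff_add, coeff_derivative] at this
    rw [coeff_X_pow_mul', if_neg (by omega)] at this
    rw [add_zero] at this
    have h2 : (X * derivative E).coeff k = E.coeff k * k := by
      cases k with
      | zero => simp
      | succ k => rw [coeff_X_mul, coeff_derivative]; push_cast; ring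
    rw [← h2, this]
  have h0 : E.coeff 0 = 1 := by
    rw [hE, finsetSum_coeff, Finset.sum_range_succ']
    simp only [coeff_smul, coeff_zero_eq_eval_zero, eval_pow, hr]
    simp
  have hc : ∀ k < n + 1, E.coeff k = (1 + X : K[X]).coeff k := by
    intro k
    induction k with
    | zero => intro _; simp [h0]
    | succ k ih =>
      intro hk
      have h1 := hrec k (by omega)
      have h2 := ih (by omega)
      have hk' : (k : K) + 1 ≠ 0 := by exact_mod_cast Nat.succ_ne_zero k
      rcases k with _ | _ | k
      · simp [h0] at h1; simp [h1, coeff_one]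
      · simp [coeff_one, coeff_X] at h2 h1 ⊢
        first
          | exact h1
          | (rw [h2] at h1; simp at h1
             have : (1 + 1 : K) ≠ 0 := by norm_num
             simpa [this] using h1)
      · simp [coeff_one, coeff_X] at h2 h1 ⊢
        rw [h2] at h1; simp at h1
        exact h1.resolve_right (by simpa using hk')
  have hdvd : X ^ (n + 1) ∣ E - (1 + X) := by
    rw [X_pow_dvd_iff]
    intro d hd; rw [coeff_sub, hc d hd, sub_self]
  obtain ⟨q, hq⟩ := hdvd
  exact ⟨q, by rw [← hq]; ring⟩

lemma klog_pow {N : ℕ} {u : A} : ∃ r, klog K N u = u * r ∧ Commute u r := by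
  refine ⟨∑ k ∈ range N, (((-1 : K)) ^ k / ((k : K) + 1)) • u ^ k, ?_, ?_⟩
  · rw [klog, Finset.mul_sum]
    refine Finset.sum_congr rfl fun k _ => ?_
    rw [mul_smul_comm, ← pow_succ']
  · refine Commute.sum_right _ _ _ fun k _ => ?_
    exact ((Commute.refl u).pow_right k).smul_right _

lemma klog_pow_eq_zero {N M : ℕ} {u : A} (h : u ^ M = 0) : (klog K N u) ^ M = 0 := by
  obtain ⟨r, hr, hc⟩ := klog_pow K (N := N) (u := u)
  rw [hr, hc.mul_pow, h, zero_mul]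

lemma kexp_klog {N : ℕ} {u : A} (h : u ^ N = 0) : kexp K (klog K N u) = 1 + u := by
  rcases N with _ | n
  · rw [pow_zero] at h
    have : ∀ z : A, z = 0 := fun z => by rw [← mul_one z, h, mul_zero]
    rw [this (kexp K _), this (1 + u)]
  · rw [kexp_eq_sum K (klog_pow_eq_zero K (N := n + 1) h)]
    obtain ⟨q, hq⟩ := kexp_klog_poly K n
    have := congrArg (Polynomial.aeval u) hq
    simp only [map_sum, map_smul, map_pow, map_add, map_mul, map_one, Polynomial.aeval_X, h,
      zero_mul, add_zero] at this
    rw [← this]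
    refine Finset.sum_congr rfl fun i _ => ?_
    congr 2
    simp [klog, map_sum]

lemma commute_kexp {a b : A} (h : Commute a b) : Commute a (kexp K b) :=
  Commute.sum_right _ _ _ fun k _ => (h.pow_right k).smul_right _

lemma commute_klog {a b : A} (N : ℕ) (h : Commute a b) : Commute a (klog K N b) :=
  Commute.sum_right _ _ _ fun k _ => (h.pow_right _).smul_right _

lemma isNilpotent_kexp_sub_one {a : A} (ha : IsNilpotent a) : IsNilpotent (kexp K a - 1) := by
  rw [kexp_eq_exp]
  let _ : Module ℚ A := Module.compHom A (algebraMap ℚ K)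
  exact IsNilpotent.isNilpotent_exp_sub_one ha

lemma klog_kexp {N : ℕ} {a : A} (ha : IsNilpotent a) (h : (kexp K a - 1) ^ N = 0) :
    klog K N (kexp K a - 1) = a := by
  have h1 := kexp_klog K h
  rw [add_sub_cancel] at h1
  set b := klog K N (kexp K a - 1) with hb
  have hbn : IsNilpotent b := ⟨N, klog_pow_eq_zero K h⟩
  have hc : Commute a b := commute_klog K N ((commute_kexp K (Commute.refl a)).sub_right
    (Commute.one_right a))
  have h2 : kexp K (b - a) = 1 := by
    rw [sub_eq_add_neg, kexp_add K hc.symm.neg_right hbn ha.neg, h1, kexp_mul_neg K ha]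
  have h3 := eq_zero_of_kexp_eq_one K (hc.symm.isNilpotent_sub hbn ha) h2
  exact sub_eq_zero.mp h3

lemma kexp_inj {a b : A} (ha : IsNilpotent a) (hb : IsNilpotent b) (h : kexp K a = kexp K b) :
    a = b := by
  obtain ⟨N, hN⟩ := isNilpotent_kexp_sub_one K ha
  rw [← klog_kexp K ha hN, ← klog_kexp K hb (h ▸ hN), h]

lemma map_kexp {B : Type} [Ring B] [Algebra K B] (f : A →ₐ[K] B) {a : A} (ha : IsNilpotent a) :
    f (kexp K a) = kexp K (f a) := by
  obtain ⟨k, hk⟩ := ha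
  rw [kexp_eq_sum K hk, kexp_eq_sum K (a := f a) (k := k) (by rw [← map_pow, hk, map_zero])]
  simp

end ExpLog

set_option linter.all false

section Words
open Finset
variable (K : Type) [Field K] [CharZero K]

/-- The index type of Dynkin's formula. -/
abbrev DIdx := Σ n : ℕ, Fin (n + 1) → ℕ × ℕ

/-- The abstract Dynkin word. -/
def dword (p : DIdx) : List Bool :=
  (List.finRange (p.1 + 1)).flatMap fun i =>
    List.replicate (p.2 i).1 true ++ List.replicate (p.2 i).2 false

def sel {M : Type} (a b : M) (t : Bool) : M := if t then a else b

lemma length_dword (p : DIdx) : (dword p).length = ∑ i, ((p.2 i).1 + (p.2 i).2) := by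
  unfold dword
  rw [List.length_flatMap, Fin.sum_univ_def]
  simp

/-- Coefficients of `log (e^x e^y)` in the free associative algebra. -/
def acoeff (p : DIdx) : K :=
  if ∀ i, 1 ≤ (p.2 i).1 + (p.2 i).2 then
    ((-1 : K) ^ p.1 / ((p.1 : K) + 1)) *
      ((∏ i, ((p.2 i).1.factorial * (p.2 i).2.factorial) : ℕ) : K)⁻¹
  else 0

lemma dynkinCoeff_eq (p : DIdx) :
    PreDGLA.dynkinCoeff K p.1 p.2 = ((dword p).length : K)⁻¹ * acoeff K p := by
  unfold PreDGLA.dynkinCoeff acoeff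
  rw [length_dword]
  split_ifs
  · ring
  · simp

lemma length_of_all {p : DIdx} (h : ∀ i, 1 ≤ (p.2 i).1 + (p.2 i).2) :
    p.1 + 1 ≤ (dword p).length := by
  rw [length_dword]
  calc p.1 + 1 = ∑ i : Fin (p.1 + 1), 1 := by simp
    _ ≤ _ := Finset.sum_le_sum fun i _ => h i

lemma length_of_acoeff {p : DIdx} (h : acoeff K p ≠ 0) : p.1 + 1 ≤ (dword p).length := by
  unfold acoeff at h
  split_ifs at h with h1
  · exact length_of_all h1
  · exact absurd rfl h

/-- A finite set of indices. -/
def PS (N : ℕ) : Finset DIdx :=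
  (range N).sigma fun n => Fintype.piFinset fun _ : Fin (n + 1) => range N ×ˢ range N

lemma mem_PS {N : ℕ} {p : DIdx} (h : acoeff K p ≠ 0) (hl : (dword p).length < N) : p ∈ PS N := by
  have h1 := length_of_acoeff K h
  rw [length_dword] at hl h1
  unfold PS
  rw [Finset.mem_sigma]
  refine ⟨by rw [Finset.mem_range]; omega, ?_⟩
  rw [Fintype.mem_piFinset]
  intro i
  have := Finset.single_le_sum (f := fun i => (p.2 i).1 + (p.2 i).2) (fun _ _ => Nat.zero_le _)
    (Finset.mem_univ i)
  simp only [Finset.mem_product, Finset.mem_range]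
  constructor <;> omega

section assoc
variable {A : Type} [Ring A] [Algebra K A]

/-- evaluation of a word in an associative algebra -/
def wprod (x y : A) (w : List Bool) : A := (w.map (sel x y)).prod

lemma list_smul_prod {ι : Type} (l : List ι) (c : ι → K) (g : ι → A) :
    (l.map fun i => c i • g i).prod = (l.map c).prod • (l.map g).prod := by
  induction l with
  | nil => simp
  | cons i l ih => simp [ih, mul_smul, smul_mul_assoc, mul_smul_comm]; rw [smul_comm]

lemma wprod_dword (x y : A) (p : DIdx) :
    wprod x y (dword p) = ((List.finRange (p.1 + 1)).map fun i => x ^ (p.2 i).1 * y ^ (p.2 i).2).prod := by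
  unfold wprod dword
  induction (List.finRange (p.1 + 1)) with
  | nil => simp
  | cons i l ih => simp [sel, ih, mul_assoc]

def ccoeff (q : ℕ × ℕ) : K :=
  if 1 ≤ q.1 + q.2 then ((q.1.factorial : K))⁻¹ * ((q.2.factorial : K))⁻¹ else 0

lemma kexp_mul_sub_one {x y : A} {N : ℕ} (hN : 0 < N) (hx : x ^ N = 0) (hy : y ^ N = 0) :
    kexp K x * kexp K y - 1 = ∑ q ∈ range N ×ˢ range N, ccoeff K q • (x ^ q.1 * y ^ q.2) := by
  rw [kexp_eq_sum K hx, kexp_eq_sum K hy, Finset.sum_mul_sum, ← Finset.sum_product']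
  have h0 : ((0, 0) : ℕ × ℕ) ∈ range N ×ˢ range N := by simp [hN]
  rw [← Finset.add_sum_erase _ _ h0, ← Finset.add_sum_erase _ (fun q : ℕ × ℕ => ccoeff K q • (x ^ q.1 * y ^ q.2)) h0]
  have : ccoeff K (0, 0) = 0 := by simp [ccoeff]
  rw [this]
  simp only [Nat.factorial_zero, Nat.cast_one, inv_one, pow_zero, one_smul, mul_one,
    add_sub_cancel_left, zero_smul, zero_add]
  refine Finset.sum_congr rfl fun q hq => ?_
  have hq' : 1 ≤ q.1 + q.2 := by
    by_contra h
    apply (Finset.mem_erase.mp hq).1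
    ext <;> simp <;> omega
  rw [ccoeff, if_pos hq', smul_mul_smul_comm]

lemma prod_ccoeff (p : DIdx) :
    ((List.finRange (p.1 + 1)).map fun i => ccoeff K (p.2 i)).prod =
      if ∀ i, 1 ≤ (p.2 i).1 + (p.2 i).2 then
        ((∏ i, ((p.2 i).1.factorial * (p.2 i).2.factorial) : ℕ) : K)⁻¹ else 0 := by
  rw [← Fin.prod_univ_def]
  split_ifs with h
  · push_cast
    rw [← Finset.prod_inv_distrib]
    refine Finset.prod_congr rfl fun i _ => ?_
    rw [ccoeff, if_pos (h i), mul_inv]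
  · push Not at h
    obtain ⟨i, hi⟩ := h
    exact Finset.prod_eq_zero (Finset.mem_univ i) (by rw [ccoeff, if_neg (by omega)])

lemma pow_expand {x y : A} {N : ℕ} (hN : 0 < N) (hx : x ^ N = 0) (hy : y ^ N = 0) (n : ℕ) :
    (kexp K x * kexp K y - 1) ^ (n + 1) =
      ∑ rs ∈ Fintype.piFinset fun _ : Fin (n + 1) => range N ×ˢ range N,
        (if ∀ i, 1 ≤ (rs i).1 + (rs i).2 then
          ((∏ i, ((rs i).1.factorial * (rs i).2.factorial) : ℕ) : K)⁻¹ else 0)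
          • wprod x y (dword ⟨n, rs⟩) := by
  rw [kexp_mul_sub_one K hN hx hy]
  have := MultilinearMap.map_sum_finset (MultilinearMap.mkPiAlgebraFin K (n + 1) A)
    (fun _ q => ccoeff K q • (x ^ q.1 * y ^ q.2)) (fun _ : Fin (n + 1) => range N ×ˢ range N)
  simp only [MultilinearMap.mkPiAlgebraFin_apply_const] at this
  rw [this]
  refine Finset.sum_congr rfl fun rs _ => ?_
  rw [← prod_ccoeff K ⟨n, rs⟩, wprod_dword, ← list_smul_prod, MultilinearMap.mkPiAlgebraFin_apply,
    List.ofFn_eq_map]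

lemma klog_expand {x y : A} {N : ℕ} (hN : 0 < N) (hx : x ^ N = 0) (hy : y ^ N = 0) :
    klog K N (kexp K x * kexp K y - 1) = ∑ p ∈ PS N, acoeff K p • wprod x y (dword p) := by
  unfold klog PS
  rw [Finset.sum_sigma]
  refine Finset.sum_congr rfl fun n _ => ?_
  rw [pow_expand K hN hx hy, Finset.smul_sum]
  refine Finset.sum_congr rfl fun rs _ => ?_
  rw [smul_smul]
  congr 1
  unfold acoeff
  split_ifs <;> simp

lemma pow_sub_one_eq_zero {x y : A} {N : ℕ} (hN : 0 < N)
    (h : ∀ w : List Bool, N ≤ w.length → wprod x y w = 0) :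
    x ^ N = 0 ∧ y ^ N = 0 ∧ (kexp K x * kexp K y - 1) ^ N = 0 := by
  have hx : x ^ N = 0 := by simpa [wprod, sel] using h (List.replicate N true) (by simp)
  have hy : y ^ N = 0 := by simpa [wprod, sel] using h (List.replicate N false) (by simp)
  refine ⟨hx, hy, ?_⟩
  obtain ⟨n, rfl⟩ : ∃ n, N = n + 1 := ⟨N - 1, by omega⟩
  rw [pow_expand K hN hx hy]
  refine Finset.sum_eq_zero fun rs _ => ?_
  split_ifs with h1
  · rw [h _ (length_of_all (p := ⟨n, rs⟩) h1), smul_zero]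
  · rw [zero_smul]

end assoc

/-- right nested brackets -/
def gnb {M : Type} [AddCommGroup M] [Module K M] (br : M →ₗ[K] M →ₗ[K] M) : List M → M
  | [] => 0
  | [x] => x
  | x :: y :: xs => br x (gnb br (y :: xs))

variable {A : Type} [Ring A] [Algebra K A]

/-- commutator bracket -/
def cbr (A : Type) [Ring A] [Algebra K A] : A →ₗ[K] A →ₗ[K] A :=
  LinearMap.mul K A - (LinearMap.mul K A).flip

@[simp] lemma cbr_apply (x y : A) : cbr K A x y = x * y - y * x := rfl

lemma cbr_eq (x : A) : cbr K A x = LinearMap.mulLeft K x - LinearMap.mulRight K x := by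
  ext y; simp

lemma expad_and_nilad :
    (∀ a : A, IsNilpotent a → kexp K (A := Module.End K A) (cbr K A a) =
      LinearMap.mulLeft K (kexp K a) * LinearMap.mulRight K (kexp K (-a))) ∧
    (∀ a : A, IsNilpotent a → IsNilpotent (R := Module.End K A) (cbr K A a)) := by
  have comLR : ∀ a b : A, Commute (LinearMap.mulLeft K a) (LinearMap.mulRight K b) :=
    fun a b => LinearMap.commute_mulLeft_right a b
  have nilL : ∀ a : A, IsNilpotent a → IsNilpotent (LinearMap.mulLeft K a) := by
    rintro a ⟨k, hk⟩; exact ⟨k, by rw [LinearMap.pow_mulLeft, hk]; simp⟩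
  have nilR : ∀ a : A, IsNilpotent a → IsNilpotent (LinearMap.mulRight K a) := by
    rintro a ⟨k, hk⟩; exact ⟨k, by rw [LinearMap.pow_mulRight, hk]; simp⟩
  have expL : ∀ a : A, IsNilpotent a →
      kexp K (LinearMap.mulLeft K a) = LinearMap.mulLeft K (kexp K a) := by
    intro a ha
    exact (map_kexp K (Algebra.lmul K A) ha).symm
  have expR : ∀ a : A, IsNilpotent a →
      kexp K (LinearMap.mulRight K a) = LinearMap.mulRight K (kexp K a) := by
    rintro a ⟨k, hk⟩
    rw [kexp_eq_sum K hk, kexp_eq_sum K (k := k) (by rw [LinearMap.pow_mulRight, hk]; simp)]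
    ext z
    simp only [LinearMap.pow_mulRight, LinearMap.mulRight_apply, Finset.mul_sum,
      LinearMap.sum_apply, LinearMap.smul_apply, mul_smul_comm]
  have expad : ∀ a : A, IsNilpotent a → kexp K (A := Module.End K A) (cbr K A a) =
      LinearMap.mulLeft K (kexp K a) * LinearMap.mulRight K (kexp K (-a)) := by
    intro a ha
    have hneg : -LinearMap.mulRight K a = LinearMap.mulRight K (-a) := by ext z; simp
    rw [cbr_eq, sub_eq_add_neg, hneg, kexp_add K (comLR _ _) (nilL a ha) (nilR _ ha.neg),
      expL a ha, expR _ ha.neg]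
  have nilad : ∀ a : A, IsNilpotent a → IsNilpotent (R := Module.End K A) (cbr K A a) := by
    intro a ha
    rw [cbr_eq]
    exact (comLR a a).isNilpotent_sub (nilL a ha) (nilR a ha)
  exact ⟨expad, nilad⟩

/-- key step: `ad (log (e^x e^y)) = log (e^{ad x} e^{ad y})` -/
lemma ad_klog {x y : A} {N : ℕ} (hN : 0 < N)
    (h : ∀ w : List Bool, N ≤ w.length → wprod x y w = 0) :
    ∃ N0, N ≤ N0 ∧ ∀ M, N0 ≤ M →
      cbr K A (∑ p ∈ PS M, acoeff K p • wprod x y (dword p)) =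
       ∑ p ∈ PS M, acoeff K p •
        wprod (A := Module.End K A) (cbr K A x) (cbr K A y) (dword p) := by
  obtain ⟨expad, nilad⟩ := expad_and_nilad K (A := A)
  obtain ⟨hx, hy, hu⟩ := pow_sub_one_eq_zero K hN h
  have hxn : IsNilpotent x := ⟨N, hx⟩
  have hyn : IsNilpotent y := ⟨N, hy⟩
  obtain ⟨nx, hnx⟩ := nilad x hxn
  obtain ⟨ny, hny⟩ := nilad y hyn
  -- the logarithm
  have hmain : ∀ M, N ≤ M → kexp K (A := Module.End K A)
        (cbr K A (klog K M (kexp K x * kexp K y - 1))) =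
        kexp K (A := Module.End K A) (cbr K A x) * kexp K (A := Module.End K A) (cbr K A y) := by
    intro M hM
    have huM := pow_eq_zero_of_le hM hu
    set θ := klog K M (kexp K x * kexp K y - 1) with hθ
    have hθn : IsNilpotent θ := ⟨M, klog_pow_eq_zero K huM⟩
    have hT : kexp K θ = kexp K x * kexp K y := by
      rw [hθ, kexp_klog K huM]; abel
    have hT' : kexp K (-θ) = kexp K (-y) * kexp K (-x) := by
      have h1 : kexp K θ * (kexp K (-y) * kexp K (-x)) = 1 := by
        rw [hT, mul_assoc, ← mul_assoc (kexp K y), kexp_mul_neg K hyn, one_mul, kexp_mul_neg K hxn]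
      calc kexp K (-θ) = kexp K (-θ) * (kexp K θ * (kexp K (-y) * kexp K (-x))) := by
            rw [h1, mul_one]
        _ = _ := by rw [← mul_assoc, kexp_neg_mul K hθn, one_mul]
    rw [expad θ hθn, expad x hxn, expad y hyn, hT, hT']
    ext z
    simp [mul_assoc]
  have hθN : IsNilpotent (klog K N (kexp K x * kexp K y - 1)) := ⟨N, klog_pow_eq_zero K hu⟩
  obtain ⟨nu, hnu⟩ := isNilpotent_kexp_sub_one K (nilad _ hθN)
  rw [hmain N le_rfl] at hnu
  refine ⟨max N (max nx (max ny nu)), le_max_left _ _, fun M hM => ?_⟩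
  have hMN : N ≤ M := le_trans (le_max_left _ _) hM
  have hM0 : 0 < M := lt_of_lt_of_le hN hMN
  have h1 : nx ≤ M := by omega
  have h2 : ny ≤ M := by omega
  have h3 : nu ≤ M := by omega
  rw [← klog_expand K hM0 (pow_eq_zero_of_le hMN hx) (pow_eq_zero_of_le hMN hy)]
  have e2 := klog_expand K hM0 (pow_eq_zero_of_le h1 hnx) (pow_eq_zero_of_le h2 hny)
  rw [← e2, ← hmain M hMN]
  refine (klog_kexp K (nilad _ ⟨M, klog_pow_eq_zero K (pow_eq_zero_of_le hMN hu)⟩) ?_).symm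
  rw [hmain M hMN]
  exact pow_eq_zero_of_le h3 hnu

lemma wprod_ad_delta {x y δ : A} (hx : δ * x - x * δ = x) (hy : δ * y - y * δ = y)
    (w : List Bool) (hw : w ≠ []) :
    wprod (A := Module.End K A) (cbr K A x) (cbr K A y) w δ
      = - gnb K (cbr K A) (w.map (sel x y)) := by
  have h1 : ∀ t, sel (M := Module.End K A) (cbr K A x) (cbr K A y) t = cbr K A (sel x y t) := by
    intro t; cases t <;> rfl
  have h2 : ∀ t, cbr K A (sel x y t) δ = - sel x y t := by
    intro t; cases t
    · simp only [sel, cbr_apply]; rw [← neg_sub]; simp [hy]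
    · simp only [sel, cbr_apply]; rw [← neg_sub]; simp [hx]
  induction w with
  | nil => exact absurd rfl hw
  | cons t w ih =>
    cases w with
    | nil => simp [wprod, gnb, h1, h2, -cbr_apply]
    | cons s w =>
      have := ih (by simp)
      unfold wprod at this ⊢
      rw [List.map_cons, List.prod_cons, Module.End.mul_apply, this, h1]
      simp [gnb, -cbr_apply]

/-- Shift operators: left multiplication by `a t^k` on power series. -/
def Sh (k : ℕ) : A →ₗ[K] Module.End K (ℕ → A) where
  toFun a :=
    { toFun := fun f m => if k ≤ m then a * f (m - k) else 0
      map_add' := by intro f g; ext m; simp only [Pi.add_apply]; split_ifs <;> simp [mul_add]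
      map_smul' := by intro c f; ext m; simp }
  map_add' := by
    intro a b; ext f m; simp only [LinearMap.coe_mk, AddHom.coe_mk, LinearMap.add_apply, Pi.add_apply]
    split_ifs <;> simp [add_mul]
  map_smul' := by intro c a; ext f m; simp

lemma Sh_apply (k : ℕ) (a : A) (f : ℕ → A) (m : ℕ) :
    Sh K k a f m = if k ≤ m then a * f (m - k) else 0 := rfl

lemma Sh_mul (j k : ℕ) (a b : A) : Sh K j a * Sh K k b = Sh K (j + k) (a * b) := by
  refine LinearMap.ext fun f => funext fun m => ?_
  rw [Module.End.mul_apply, Sh_apply, Sh_apply, Sh_apply]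
  by_cases h : j + k ≤ m
  · rw [if_pos (by omega), if_pos (by omega), if_pos h, mul_assoc, Nat.sub_sub]
  · rw [if_neg h]
    split_ifs
    · omega
    · simp
    · rfl

def Del (A : Type) [Ring A] [Algebra K A] : Module.End K (ℕ → A) where
  toFun f := fun m => (m : K) • f m
  map_add' := by intro f g; ext m; simp
  map_smul' := by
    intro c f; ext m; simp only [Pi.smul_apply, RingHom.id_apply]; rw [smul_comm]

lemma Del_Sh (k : ℕ) (a : A) :
    Del K A * Sh K k a - Sh K k a * Del K A = (k : K) • Sh K k a := by
  refine LinearMap.ext fun f => funext fun m => ?_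
  simp only [LinearMap.sub_apply, Module.End.mul_apply, Pi.sub_apply, LinearMap.smul_apply,
    Pi.smul_apply, Sh_apply]
  change (m : K) • (Sh K k a f m) - _ = _
  rw [Sh_apply]
  split_ifs with h
  · change (m : K) • (a * f (m - k)) - a * (((m - k : ℕ) : K) • f (m - k)) = _
    rw [mul_smul_comm, ← sub_smul, Nat.cast_sub h]
    congr 1; ring
  · simp

lemma wprod_Sh (x y : A) (w : List Bool) :
    wprod (Sh K 1 x) (Sh K 1 y) w = Sh K w.length (wprod x y w) := by
  induction w with
  | nil =>
    refine LinearMap.ext fun f => funext fun m => ?_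
    simp [wprod, Sh_apply]
  | cons t w ih =>
    have h1 : sel (Sh K 1 x) (Sh K 1 y) t = Sh K 1 (sel x y t) := by cases t <;> rfl
    unfold wprod at ih ⊢
    rw [List.map_cons, List.prod_cons, ih, h1, Sh_mul, List.map_cons, List.prod_cons, List.length_cons,
      add_comm]

lemma gnb_Sh (x y : A) (w : List Bool) (hw : w ≠ []) :
    gnb K (cbr K (Module.End K (ℕ → A))) (w.map (sel (Sh K 1 x) (Sh K 1 y))) =
      Sh K w.length (gnb K (cbr K A) (w.map (sel x y))) := by
  have h1 : ∀ t, sel (Sh K 1 x) (Sh K 1 y) t = Sh K 1 (sel x y t) := by intro t; cases t <;> rfl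
  induction w with
  | nil => exact absurd rfl hw
  | cons t w ih =>
    cases w with
    | nil => simp [gnb, h1]
    | cons s w =>
      have := ih (by simp)
      simp only [List.map_cons] at this ⊢
      rw [gnb, this, h1, cbr_apply, Sh_mul, Sh_mul, gnb, cbr_apply, map_sub]
      simp only [List.length_cons]
      rw [add_comm 1]

/-- Associative Baker-Campbell-Hausdorff-Dynkin. -/
theorem assoc_bch {x y : A} {N : ℕ} (hN : 0 < N)
    (h : ∀ w : List Bool, N ≤ w.length → wprod x y w = 0) :
    ∃ N0, N ≤ N0 ∧ ∀ M, N0 ≤ M →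
      ∑ p ∈ PS M, PreDGLA.dynkinCoeff K p.1 p.2 • gnb K (cbr K A) ((dword p).map (sel x y)) =
        klog K M (kexp K x * kexp K y - 1) := by
  have hB : ∀ w : List Bool, N ≤ w.length → wprod (Sh K 1 x) (Sh K 1 y) w = 0 := by
    intro w hw; rw [wprod_Sh, h w hw, map_zero]
  obtain ⟨N0, hN0, hmain⟩ := ad_klog K hN hB
  obtain ⟨hx, hy, -⟩ := pow_sub_one_eq_zero K hN h
  refine ⟨N0, hN0, fun M hM => ?_⟩
  have hMN : N ≤ M := le_trans hN0 hM
  rw [klog_expand K (lt_of_lt_of_le hN hMN) (pow_eq_zero_of_le hMN hx) (pow_eq_zero_of_le hMN hy)]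
  have e1 := LinearMap.congr_fun (hmain M hM) (Del K A)
  have hne : ∀ p : DIdx, acoeff K p ≠ 0 → dword p ≠ [] := by
    intro p hp h0
    have := length_of_acoeff K hp
    rw [h0] at this; simp at this
  have hX : ∀ z : A, Del K A * Sh K 1 z - Sh K 1 z * Del K A = Sh K 1 z := by
    intro z; rw [Del_Sh]; simp
  have e2 : ∑ p ∈ PS M, acoeff K p • Sh K (dword p).length
      (((dword p).length : K) • wprod x y (dword p)
        - gnb K (cbr K A) ((dword p).map (sel x y))) = 0 := by
    rw [map_sum, LinearMap.sum_apply, LinearMap.sum_apply] at e1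
    rw [← sub_eq_zero, ← Finset.sum_sub_distrib] at e1
    rw [← neg_eq_zero, ← e1, ← Finset.sum_neg_distrib]
    refine Finset.sum_congr rfl fun p _ => ?_
    by_cases hp : acoeff K p = 0
    · simp [hp]
    · rw [map_smul, LinearMap.smul_apply, LinearMap.smul_apply, wprod_ad_delta K (hX x) (hX y) _ (hne p hp),
        gnb_Sh K _ _ _ (hne p hp), wprod_Sh, cbr_apply, ← smul_sub]
      refine Eq.trans (smul_neg _ _).symm ?_
      congr 1
      rw [← neg_sub (Del K A * _), Del_Sh, map_sub, map_smul]
      abel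
  -- extract
  let J : (ℕ → A) →ₗ[K] A :=
    ∑ k ∈ range ((PS M).sup (fun p => (dword p).length) + 1), (k : K)⁻¹ • LinearMap.proj k
  have hJ : ∀ p ∈ PS M, ∀ a : A, J (Sh K (dword p).length a (fun m => if m = 0 then 1 else 0)) =
      ((dword p).length : K)⁻¹ • a := by
    intro p hp a
    have hle := Finset.le_sup (f := fun p => (dword p).length) hp
    simp only [J, LinearMap.sum_apply, LinearMap.smul_apply, LinearMap.proj_apply, Sh_apply]
    rw [Finset.sum_eq_single (dword p).length]
    · simp
    · intro k _ hk
      split_ifs with h1 h2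
      · omega
      · simp
      · simp
    · intro hk; exact absurd (Finset.mem_range.mpr (Nat.lt_succ_of_le hle)) hk
  have e3 := congrArg (fun T : Module.End K (ℕ → A) => J (T (fun m => if m = 0 then 1 else 0))) e2
  simp only [LinearMap.sum_apply, map_sum, LinearMap.smul_apply, map_smul, LinearMap.zero_apply,
    map_zero] at e3
  rw [eq_comm, ← sub_eq_zero, ← Finset.sum_sub_distrib, ← e3]
  refine Finset.sum_congr rfl fun p hp => ?_
  rw [hJ p hp, dynkinCoeff_eq]
  by_cases hp0 : acoeff K p = 0
  · simp [hp0]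
  · have hl : ((dword p).length : K) ≠ 0 := by
      have := length_of_acoeff K hp0
      exact_mod_cast (by omega : (dword p).length ≠ 0)
    rw [mul_comm, mul_smul, ← smul_sub, smul_sub _ (_ • _), smul_smul _ _ (wprod _ _ _), inv_mul_cancel₀ hl, one_smul]

end Words

set_option linter.all false

section RawLie
open Finset
variable (K : Type) [Field K] [CharZero K]
variable {M : Type} [AddCommGroup M] [Module K M]
variable {M' : Type} [AddCommGroup M'] [Module K M']

lemma kexp_intertwine {V W : Type} [AddCommGroup V] [Module K V] [AddCommGroup W] [Module K W]
    (f : V →ₗ[K] W) {S : Module.End K V} {T : Module.End K W} (hS : IsNilpotent S)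
    (hT : IsNilpotent T) (h : ∀ v, f (S v) = T (f v)) (v : V) :
    f (kexp K S v) = kexp K T (f v) := by
  obtain ⟨a, ha⟩ := hS
  obtain ⟨b, hb⟩ := hT
  rw [kexp_eq_sum K (pow_eq_zero_of_le (le_max_left a b) ha),
    kexp_eq_sum K (pow_eq_zero_of_le (le_max_right a b) hb)]
  simp only [LinearMap.sum_apply, LinearMap.smul_apply, map_sum, map_smul]
  have hi : ∀ i : ℕ, f ((S ^ i) v) = (T ^ i) (f v) := by
    intro i
    induction i with
    | zero => simp
    | succ i ih => rw [pow_succ', pow_succ', Module.End.mul_apply, Module.End.mul_apply, h, ih]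
  exact Finset.sum_congr rfl fun i _ => by rw [hi]

/-- If `D` acts as a derivation on a bilinear map then `exp D` acts as an automorphism. -/
lemma kexp_bilin {V V' W : Type} [AddCommGroup V] [Module K V] [AddCommGroup V'] [Module K V']
    [AddCommGroup W] [Module K W] (β : V →ₗ[K] V' →ₗ[K] W)
    {D : Module.End K V} {D' : Module.End K V'} {E : Module.End K W}
    (hD : IsNilpotent D) (hD' : IsNilpotent D') (hE : IsNilpotent E)
    (h : ∀ v v', E (β v v') = β (D v) v' + β v (D' v')) (v : V) (v' : V') :
    kexp K E (β v v') = β (kexp K D v) (kexp K D' v') := by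
  let DR : Module.End K (V ⊗[K] V') := D.rTensor V'
  let DL : Module.End K (V ⊗[K] V') := D'.lTensor V
  have nR : IsNilpotent DR := by
    obtain ⟨k, hk⟩ := hD
    exact ⟨k, by rw [show DR ^ k = (D ^ k).rTensor V' from LinearMap.rTensor_pow _ _, hk]; simp⟩
  have nL : IsNilpotent DL := by
    obtain ⟨k, hk⟩ := hD'
    exact ⟨k, by rw [show DL ^ k = (D' ^ k).lTensor V from LinearMap.lTensor_pow _ _, hk]; simp⟩
  have hc : Commute DR DL := by
    change D.rTensor V' ∘ₗ D'.lTensor V = D'.lTensor V ∘ₗ D.rTensor V'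
    rw [LinearMap.rTensor_comp_lTensor, LinearMap.lTensor_comp_rTensor]
  have h1 := kexp_intertwine K (TensorProduct.lift β) (hc.isNilpotent_add nR nL) hE (by
    intro t
    induction t using TensorProduct.induction_on with
    | zero => simp
    | tmul a b => simp [DR, DL, h]
    | add a b ha hb => simp only [map_add, ha, hb]) (v ⊗ₜ v')
  rw [TensorProduct.lift.tmul] at h1
  rw [← h1, kexp_add K hc nR nL, Module.End.mul_apply]
  have h2 := kexp_intertwine K (TensorProduct.mk K V V' v) hD' nL (by intro z; simp [DL]) v'
  rw [TensorProduct.mk_apply] at h2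
  rw [TensorProduct.mk_apply] at h2
  have h3 := kexp_intertwine K ((TensorProduct.mk K V V').flip (kexp K D' v')) hD nR
    (by intro z; simp [DR]) v
  simp only [LinearMap.flip_apply, TensorProduct.mk_apply] at h3
  rw [← h2, ← h3, TensorProduct.lift.tmul]

/-- A Lie bracket given as a bilinear map. -/
structure LieBr (br : M →ₗ[K] M →ₗ[K] M) : Prop where
  anti : ∀ x y, br x y = - br y x
  jac : ∀ x y z, br x (br y z) = br (br x y) z + br y (br x z)

def NilB (br : M →ₗ[K] M →ₗ[K] M) (N : ℕ) : Prop :=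
  ∀ l : List M, N ≤ l.length → gnb K br l = 0

def gbch (br : M →ₗ[K] M →ₗ[K] M) (a b : M) : M :=
  ∑ᶠ p : DIdx, PreDGLA.dynkinCoeff K p.1 p.2 • gnb K br ((dword p).map (sel a b))

lemma gnb_cons (br : M →ₗ[K] M →ₗ[K] M) (x : M) (l : List M) (hl : l ≠ []) :
    gnb K br (x :: l) = br x (gnb K br l) := by
  cases l with
  | nil => exact absurd rfl hl
  | cons y l => rfl

lemma gbch_eq_sum {br : M →ₗ[K] M →ₗ[K] M} {N : ℕ} (h : NilB K br N) {n : ℕ} (hn : N ≤ n)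
    (a b : M) : gbch K br a b =
      ∑ p ∈ PS n, PreDGLA.dynkinCoeff K p.1 p.2 • gnb K br ((dword p).map (sel a b)) := by
  unfold gbch
  refine finsum_eq_sum_of_support_subset _ fun p hp => ?_
  rw [Function.mem_support] at hp
  have h1 : acoeff K p ≠ 0 := by
    intro h0; apply hp; rw [dynkinCoeff_eq, h0, mul_zero, zero_smul]
  refine mem_PS K h1 ?_
  by_contra hlen
  apply hp
  rw [h _ (by rw [List.length_map]; omega), smul_zero]

lemma map_gnb {br : M →ₗ[K] M →ₗ[K] M} {br' : M' →ₗ[K] M' →ₗ[K] M'} (f : M →ₗ[K] M')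
    (hf : ∀ x y, f (br x y) = br' (f x) (f y)) (a b : M) (w : List Bool) :
    f (gnb K br (w.map (sel a b))) = gnb K br' (w.map (sel (f a) (f b))) := by
  have h1 : ∀ t, f (sel a b t) = sel (f a) (f b) t := by intro t; cases t <;> rfl
  induction w with
  | nil => simp [gnb]
  | cons t w ih =>
    cases w with
    | nil => simp [gnb, h1]
    | cons s w =>
      simp only [List.map_cons] at ih ⊢
      rw [gnb, hf, ih, h1]; rfl

lemma map_gbch {br : M →ₗ[K] M →ₗ[K] M} {br' : M' →ₗ[K] M' →ₗ[K] M'} (f : M →ₗ[K] M')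
    (hf : ∀ x y, f (br x y) = br' (f x) (f y)) {N N' : ℕ} (h : NilB K br N) (h' : NilB K br' N')
    (a b : M) : f (gbch K br a b) = gbch K br' (f a) (f b) := by
  rw [gbch_eq_sum K h (le_max_left N N'), gbch_eq_sum K h' (le_max_right N N'), map_sum]
  refine Finset.sum_congr rfl fun p _ => ?_
  rw [map_smul, map_gnb K f hf]

lemma gnb_mem {br : M →ₗ[K] M →ₗ[K] M} (S : Submodule K M)
    (hS : ∀ x ∈ S, ∀ y ∈ S, br x y ∈ S) (l : List M) (hl : ∀ x ∈ l, x ∈ S) :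
    gnb K br l ∈ S := by
  induction l with
  | nil => exact S.zero_mem
  | cons x l ih =>
    cases l with
    | nil => simpa [gnb] using hl
    | cons y l =>
      rw [gnb]
      exact hS _ (hl x (by simp)) _ (ih fun z hz => hl z (by simp_all))

lemma gbch_mem {br : M →ₗ[K] M →ₗ[K] M} {N : ℕ} (h : NilB K br N) (S : Submodule K M)
    (hS : ∀ x ∈ S, ∀ y ∈ S, br x y ∈ S) {a b : M} (ha : a ∈ S) (hb : b ∈ S) :
    gbch K br a b ∈ S := by
  rw [gbch_eq_sum K h le_rfl]
  refine S.sum_mem fun p _ => S.smul_mem _ (gnb_mem K S hS _ ?_)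
  intro x hx
  obtain ⟨t, -, rfl⟩ := List.mem_map.mp hx
  cases t
  · exact hb
  · exact ha

lemma gbch_zero_zero {br : M →ₗ[K] M →ₗ[K] M} {N : ℕ} (h : NilB K br N) :
    gbch K br (0 : M) 0 = 0 := by
  have := gbch_mem K h (⊥ : Submodule K M) (by simp) (a := 0) (b := 0) (by simp) (by simp)
  simpa using this

/-- BCH in a representation. -/
theorem rep_bch {A : Type} [Ring A] [Algebra K A] {br : M →ₗ[K] M →ₗ[K] M} (ρ : M →ₗ[K] A)
    (hρ : ∀ x y, ρ (br x y) = ρ x * ρ y - ρ y * ρ x) {N : ℕ} (hN : NilB K br N) {N' : ℕ}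
    (hv : ∀ l : List M, N' ≤ l.length → (l.map ρ).prod = 0) (a b : M) :
    kexp K (ρ (gbch K br a b)) = kexp K (ρ a) * kexp K (ρ b) := by
  have hw : ∀ w : List Bool, N' + 1 ≤ w.length → wprod (ρ a) (ρ b) w = 0 := by
    intro w hw
    rw [← hv (w.map (sel a b)) (by rw [List.length_map]; omega), wprod, List.map_map]
    congr 1
    refine List.map_congr_left fun t _ => ?_
    cases t <;> rfl
  obtain ⟨N0, h0, hmain⟩ := assoc_bch K (Nat.succ_pos N') hw
  obtain ⟨hx, hy, hu⟩ := pow_sub_one_eq_zero K (Nat.succ_pos N') hw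
  have hM := hmain (max N0 N) (le_max_left _ _)
  have : ρ (gbch K br a b) = klog K (max N0 N) (kexp K (ρ a) * kexp K (ρ b) - 1) := by
    rw [← hM, gbch_eq_sum K hN (le_max_right N0 N), map_sum]
    refine Finset.sum_congr rfl fun p _ => ?_
    rw [map_smul, map_gnb K (br' := cbr K A) ρ (by intro x y; rw [hρ]; rfl)]
  rw [this, kexp_klog K (pow_eq_zero_of_le (le_trans h0 (le_max_left _ _)) hu)]
  abel

/-- Affine representation attached to a module and a 1-cocycle. -/
def affRep {W : Type} [AddCommGroup W] [Module K W] (act : M →ₗ[K] Module.End K W)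
    (c : M →ₗ[K] W) : M →ₗ[K] Module.End K (K × W) where
  toFun a := LinearMap.prod 0 (act a ∘ₗ LinearMap.snd K K W -
    (LinearMap.toSpanSingleton K W (c a)) ∘ₗ LinearMap.fst K K W)
  map_add' := by
    intro a b; refine LinearMap.ext fun v => ?_; ext
    · simp
    · simp; abel
  map_smul' := by
    intro k a; refine LinearMap.ext fun v => ?_; ext
    · simp
    · simp only [map_smul, LinearMap.prod_apply, Function.prod_apply, LinearMap.sub_apply, LinearMap.comp_apply, LinearMap.snd_apply, LinearMap.fst_apply, LinearMap.toSpanSingleton_apply, LinearMap.smul_apply, RingHom.id_apply, Prod.smul_snd, smul_sub]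
      rw [smul_comm]

section aff
variable {W : Type} [AddCommGroup W] [Module K W] (act : M →ₗ[K] Module.End K W) (c : M →ₗ[K] W)

lemma affRep_apply (a : M) (v : K × W) : affRep K act c a v = (0, act a v.2 - v.1 • c a) := rfl

lemma affRep_lie {br : M →ₗ[K] M →ₗ[K] M}
    (hact : ∀ x y, act (br x y) = act x * act y - act y * act x)
    (hc : ∀ x y, c (br x y) = act x (c y) - act y (c x)) (x y : M) :
    affRep K act c (br x y) =
      affRep K act c x * affRep K act c y - affRep K act c y * affRep K act c x := by
  refine LinearMap.ext fun v => ?_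
  simp only [LinearMap.sub_apply, Module.End.mul_apply, affRep_apply, hact, hc]
  ext
  · simp
  · simp [smul_sub]; abel

lemma affRep_prod {N : ℕ} (hv : ∀ l : List M, N ≤ l.length → (l.map act).prod = 0)
    (l : List M) (hl : N + 1 ≤ l.length) : (l.map (affRep K act c)).prod = 0 := by
  have h1 : ∀ (l : List M) (w : W), (l.map (affRep K act c)).prod (0, w) = (0, (l.map act).prod w) := by
    intro l w
    induction l with
    | nil => simp
    | cons x l ih => simp [ih, affRep_apply]
  obtain ⟨l', x, rfl⟩ : ∃ l' x, l = l' ++ [x] := by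
    rcases List.eq_nil_or_concat l with h | ⟨l', x, h⟩
    · subst h; simp at hl
    · exact ⟨l', x, by simpa using h⟩
  refine LinearMap.ext fun v => ?_
  rw [List.map_append, List.prod_append, Module.End.mul_apply]
  simp only [List.map_cons, List.map_nil, List.prod_singleton, affRep_apply]
  rw [h1, hv l' (by simp at hl; omega)]
  rfl

lemma affRep_nilp {N : ℕ} (hv : ∀ l : List M, N ≤ l.length → (l.map act).prod = 0) (a : M) :
    (affRep K act c a) ^ (N + 1) = 0 := by
  have := affRep_prod K act c hv (List.replicate (N + 1) a) (by simp)
  simpa using this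

lemma act_pow {N : ℕ} (hv : ∀ l : List M, N ≤ l.length → (l.map act).prod = 0) (a : M) :
    (act a) ^ N = 0 := by
  simpa using hv (List.replicate N a) (by simp)

lemma kexp_affRep {N : ℕ} (hv : ∀ l : List M, N ≤ l.length → (l.map act).prod = 0) (a : M) (w : W) :
    kexp K (affRep K act c a) (1, w) =
      (1, w + ∑ n ∈ range N, (((n + 1).factorial : K))⁻¹ • ((act a) ^ n) (act a w - c a)) := by
  rw [kexp_eq_sum K (affRep_nilp K act c hv a), LinearMap.sum_apply, Finset.sum_range_succ']
  have h1 : ∀ n, (affRep K act c a ^ (n + 1)) (1, w) = (0, (act a ^ n) (act a w - c a)) := by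
    intro n
    induction n with
    | zero => simp [affRep_apply]
    | succ n ih => rw [pow_succ', Module.End.mul_apply, ih, affRep_apply, pow_succ']; simp
  simp only [LinearMap.smul_apply, h1]
  ext
  · simp [Prod.fst_sum]
  · simp [Prod.snd_sum, add_comm]
end aff

/-- Tensoring brackets. -/
def tbr {Q : Type} [AddCommGroup Q] [Module K Q] (br : M →ₗ[K] M →ₗ[K] M) (mul : Q →ₗ[K] Q →ₗ[K] Q) :
    (M ⊗[K] Q) →ₗ[K] (M ⊗[K] Q) →ₗ[K] (M ⊗[K] Q) :=
  TensorProduct.curry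
    ((TensorProduct.map (TensorProduct.lift br) (TensorProduct.lift mul)).comp
      (TensorProduct.tensorTensorTensorComm K M Q M Q).toLinearMap)

@[simp] lemma tbr_tmul {Q : Type} [AddCommGroup Q] [Module K Q] (br : M →ₗ[K] M →ₗ[K] M)
    (mul : Q →ₗ[K] Q →ₗ[K] Q) (x y : M) (p q : Q) :
    tbr K br mul (x ⊗ₜ p) (y ⊗ₜ q) = br x y ⊗ₜ mul p q := by
  simp [tbr]

/-- general filtration argument for nilpotency of tensored brackets -/
lemma nil_tbr {Q : Type} [AddCommGroup Q] [Module K Q] (br : M →ₗ[K] M →ₗ[K] M)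
    (mul : Q →ₗ[K] Q →ₗ[K] Q) (F : ℕ → M → Q → Prop)
    (h1 : ∀ x q, F 1 x q) (hs : ∀ k x q y r, F k y r → 1 ≤ k → F (k + 1) (br x y) (mul q r))
    {N : ℕ} (h0 : ∀ k x q, N ≤ k → F k x q → x ⊗ₜ[K] q = 0) : NilB K (tbr K br mul) N := by
  have key : ∀ l : List (M ⊗[K] Q), l ≠ [] →
      gnb K (tbr K br mul) l ∈ Submodule.span K {z | ∃ x q, F l.length x q ∧ z = x ⊗ₜ[K] q} := by
    intro l hl
    induction l with
    | nil => exact absurd rfl hl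
    | cons t l ih =>
      cases l with
      | nil =>
        simp only [gnb]
        induction t using TensorProduct.induction_on with
        | zero => exact Submodule.zero_mem _
        | tmul a b => exact Submodule.subset_span ⟨a, b, h1 a b, rfl⟩
        | add a b ha hb => exact Submodule.add_mem _ (ha (by simp)) (hb (by simp))
      | cons s l =>
        have hi := ih (by simp)
        rw [gnb]
        generalize gnb K (tbr K br mul) (s :: l) = z at hi
        induction hi using Submodule.span_induction with
        | zero => simp
        | add a b _ _ ha hb => rw [map_add]; exact Submodule.add_mem _ ha hb
        | smul c a _ ha => rw [map_smul]; exact Submodule.smul_mem _ _ ha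
        | mem z hz =>
          obtain ⟨y, r, hF, rfl⟩ := hz
          clear ih
          induction t using TensorProduct.induction_on with
          | zero => simp
          | tmul a b =>
            rw [tbr_tmul]
            exact Submodule.subset_span ⟨_, _, hs _ a b y r hF (by simp), rfl⟩
          | add a b ha hb =>
            rw [map_add, LinearMap.add_apply]; exact Submodule.add_mem _ (ha (by simp)) (hb (by simp))
  intro l hl
  by_cases hn : l = []
  · subst hn; rfl
  · have := key l hn
    have hbot : Submodule.span K {z | ∃ x q, F l.length x q ∧ z = x ⊗ₜ[K] q} = ⊥ := by
      rw [Submodule.span_eq_bot]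
      rintro z ⟨x, q, hF, rfl⟩
      exact h0 _ x q hl hF
    rw [hbot] at this
    simpa using this

lemma NilB.prod_eq_zero {br : M →ₗ[K] M →ₗ[K] M} {N : ℕ} (h : NilB K br N) (l : List M)
    (hl : N ≤ l.length) : (l.map (fun x => (br x : Module.End K M))).prod = 0 := by
  refine LinearMap.ext fun z => ?_
  have h1 : ∀ l : List M, (l.map (fun x => (br x : Module.End K M))).prod z = gnb K br (l ++ [z]) := by
    intro l
    induction l with
    | nil => simp [gnb]
    | cons x l ih => rw [List.map_cons, List.prod_cons, Module.End.mul_apply, ih, List.cons_append,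
        gnb_cons _ _ _ _ (by simp)]
  rw [h1, h _ (by simp; omega)]; rfl

lemma NilB.br_pow {br : M →ₗ[K] M →ₗ[K] M} {N : ℕ} (h : NilB K br N) (a : M) :
    (br a : Module.End K M) ^ N = 0 := by
  simpa using h.prod_eq_zero K (List.replicate N a) (by simp)

end RawLie

set_option linter.all false

section GroupLaw
open Finset Polynomial
variable (K : Type) [Field K] [CharZero K]
variable {M : Type} [AddCommGroup M] [Module K M]

abbrev pbr (br : M →ₗ[K] M →ₗ[K] M) := tbr K br (LinearMap.mul K K[X])

lemma tbr_anti {Q : Type} [AddCommGroup Q] [Module K Q] {br : M →ₗ[K] M →ₗ[K] M}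
    {mul : Q →ₗ[K] Q →ₗ[K] Q} (hb : ∀ x y, br x y = - br y x) (hm : ∀ p q, mul p q = mul q p)
    (u v : M ⊗[K] Q) : tbr K br mul u v = - tbr K br mul v u := by
  induction u using TensorProduct.induction_on with
  | zero => simp
  | add a b ha hb => simp only [map_add, LinearMap.add_apply, ha, hb]; abel
  | tmul x p =>
    induction v using TensorProduct.induction_on with
    | zero => simp
    | add a b ha hb => simp only [map_add, LinearMap.add_apply, ha, hb]; abel
    | tmul y q => rw [tbr_tmul, tbr_tmul, hb x y, hm p q, TensorProduct.neg_tmul]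

lemma tbr_jac {Q : Type} [AddCommGroup Q] [Module K Q] {br : M →ₗ[K] M →ₗ[K] M}
    {mul : Q →ₗ[K] Q →ₗ[K] Q}
    (hj : ∀ x y z, br x (br y z) = br (br x y) z + br y (br x z))
    (h1 : ∀ p q r, mul p (mul q r) = mul (mul p q) r)
    (h2 : ∀ p q r, mul p (mul q r) = mul q (mul p r))
    (u v w : M ⊗[K] Q) : tbr K br mul u (tbr K br mul v w) =
      tbr K br mul (tbr K br mul u v) w + tbr K br mul v (tbr K br mul u w) := by
  induction u using TensorProduct.induction_on with
  | zero => simp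
  | add a b ha hb => simp only [map_add, LinearMap.add_apply, ha, hb]; abel
  | tmul x p =>
    induction v using TensorProduct.induction_on with
    | zero => simp
    | add a b ha hb => simp only [map_add, LinearMap.add_apply, ha, hb]; abel
    | tmul y q =>
      induction w using TensorProduct.induction_on with
      | zero => simp
      | add a b ha hb => simp only [map_add, ha, hb]; abel
      | tmul z r =>
        simp only [tbr_tmul]
        rw [hj, TensorProduct.add_tmul, ← h1, ← h2]

lemma pbr_lie {br : M →ₗ[K] M →ₗ[K] M} (h : LieBr K br) : LieBr K (pbr K br) where
  anti := tbr_anti K h.anti (by intro p q; exact mul_comm p q)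
  jac := tbr_jac K h.jac (by intro p q r; exact (mul_assoc p q r).symm)
    (by intro p q r; exact mul_left_comm p q r)

lemma pbr_nil {br : M →ₗ[K] M →ₗ[K] M} {N : ℕ} (h : NilB K br N) : NilB K (pbr K br) N := by
  refine nil_tbr K br _ (fun k x q => ∃ l : List M, l.length = k ∧ x = gnb K br l) ?_ ?_ ?_
  · intro x q; exact ⟨[x], rfl, rfl⟩
  · rintro k x q y r ⟨l, hl, rfl⟩ hk
    refine ⟨x :: l, by simp [hl], ?_⟩
    rw [gnb_cons]
    rintro rfl
    simp at hl; omega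
  · rintro k x q hk ⟨l, hl, rfl⟩
    rw [h l (by omega), TensorProduct.zero_tmul]

def pdel (M : Type) [AddCommGroup M] [Module K M] : (M ⊗[K] K[X]) →ₗ[K] (M ⊗[K] K[X]) :=
  LinearMap.lTensor M ((LinearMap.mulLeft K (X : K[X])) ∘ₗ Polynomial.derivative)

lemma pdel_tmul (x : M) (p : K[X]) : pdel K M (x ⊗ₜ p) = x ⊗ₜ (X * derivative p) := rfl

lemma pdel_pbr (br : M →ₗ[K] M →ₗ[K] M) (u v : M ⊗[K] K[X]) :
    pdel K M (pbr K br u v) = pbr K br (pdel K M u) v + pbr K br u (pdel K M v) := by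
  induction u using TensorProduct.induction_on with
  | zero => simp
  | add a b ha hb => simp only [map_add, LinearMap.add_apply, ha, hb]; abel
  | tmul x p =>
    induction v using TensorProduct.induction_on with
    | zero => simp
    | add a b ha hb => simp only [map_add, LinearMap.add_apply, ha, hb]; abel
    | tmul y q =>
      simp only [tbr_tmul, pdel_tmul, LinearMap.mul_apply']
      rw [← TensorProduct.tmul_add, derivative_mul]
      congr 1; ring

def pev (M : Type) [AddCommGroup M] [Module K M] (s : K) : (M ⊗[K] K[X]) →ₗ[K] M :=
  (TensorProduct.rid K M).toLinearMap ∘ₗ LinearMap.lTensor M (Polynomial.leval s)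

lemma pev_tmul (s : K) (x : M) (p : K[X]) : pev K M s (x ⊗ₜ p) = p.eval s • x := by
  simp [pev, Polynomial.leval]

lemma pev_pbr (br : M →ₗ[K] M →ₗ[K] M) (s : K) (u v : M ⊗[K] K[X]) :
    pev K M s (pbr K br u v) = br (pev K M s u) (pev K M s v) := by
  induction u using TensorProduct.induction_on with
  | zero => simp
  | add a b ha hb => simp only [map_add, LinearMap.add_apply, ha, hb]
  | tmul x p =>
    induction v using TensorProduct.induction_on with
    | zero => simp
    | add a b ha hb => simp only [map_add, ha, hb]
    | tmul y q => simp [pev_tmul, smul_smul, mul_comm]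

def pint : K[X] →ₗ[K] K := Polynomial.lsum (fun n => ((n : K)⁻¹) • (LinearMap.id : K →ₗ[K] K))

lemma pint_spec (p : K[X]) : p.eval 1 = p.eval 0 + pint K (X * derivative p) := by
  induction p using Polynomial.induction_on' with
  | add p q hp hq => simp only [eval_add, hp, hq, derivative_add, mul_add, map_add]; ring
  | monomial n a =>
    rw [derivative_monomial]
    cases n with
    | zero => simp
    | succ n =>
      have : (X : K[X]) * monomial (n + 1 - 1) (a * ((n + 1 : ℕ) : K)) =
          monomial (n + 1) (a * ((n + 1 : ℕ) : K)) := by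
        rw [X_mul_monomial]; rfl
      rw [this, pint, Polynomial.lsum_apply, Polynomial.sum_monomial_index _ _ (by simp)]
      have h0 : ((n + 1 : ℕ) : K) ≠ 0 := Nat.cast_ne_zero.mpr (by omega)
      simp only [eval_monomial, one_pow, mul_one, LinearMap.smul_apply, LinearMap.id_apply, smul_eq_mul]
      field_simp
      simp

lemma pev_del (u v : M ⊗[K] K[X]) (h : pdel K M u = pdel K M v) (h0 : pev K M 0 u = pev K M 0 v) :
    pev K M 1 u = pev K M 1 v := by
  have key : ∀ u, pev K M 1 u = pev K M 0 u +
      (TensorProduct.rid K M) (LinearMap.lTensor M (pint K) (pdel K M u)) := by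
    intro u
    induction u using TensorProduct.induction_on with
    | zero => simp
    | add a b ha hb => simp only [map_add, ha, hb]; abel
    | tmul x p =>
      rw [pev_tmul, pev_tmul, pdel_tmul, LinearMap.lTensor_tmul, TensorProduct.rid_tmul, pint_spec,
        add_smul]
  rw [key, key v, h, h0]

def prho (br : M →ₗ[K] M →ₗ[K] M) : (M ⊗[K] K[X]) →ₗ[K] Module.End K (K × (M ⊗[K] K[X])) :=
  affRep K (pbr K br) (pdel K M)

section
variable {K}
variable {br : M →ₗ[K] M →ₗ[K] M}

lemma prho_lie (hL : LieBr K br) {N : ℕ} (hN : NilB K br N) (x y) : prho K br (pbr K br x y) = prho K br x * prho K br y - prho K br y * prho K br x := by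
  refine affRep_lie K _ _ ?_ ?_ x y
  · intro x y
    refine LinearMap.ext fun z => ?_
    have := (pbr_lie K hL).jac x y z
    simp only [LinearMap.sub_apply, Module.End.mul_apply]
    exact eq_sub_of_add_eq this.symm
  · intro x y
    rw [pdel_pbr, (pbr_lie K hL).anti (pdel K M x)]; abel

lemma prho_prod (hL : LieBr K br) {N : ℕ} (hN : NilB K br N) (l : List (M ⊗[K] K[X])) (hl : N + 1 ≤ l.length) : (l.map (prho K br)).prod = 0 :=
  affRep_prod K _ _ ((pbr_nil K hN).prod_eq_zero K) l hl

lemma prho_nilp (hL : LieBr K br) {N : ℕ} (hN : NilB K br N) (x) : IsNilpotent (prho K br x) :=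
  ⟨N + 1, affRep_nilp K _ _ ((pbr_nil K hN).prod_eq_zero K) x⟩

lemma prho_bch (hL : LieBr K br) {N : ℕ} (hN : NilB K br N) (x y) : kexp K (prho K br (gbch K (pbr K br) x y)) =
    kexp K (prho K br x) * kexp K (prho K br y) :=
  rep_bch K _ (prho_lie hL hN) (pbr_nil K hN) (prho_prod hL hN) x y

lemma prho_faith (hL : LieBr K br) {N : ℕ} (hN : NilB K br N) (P Q : M ⊗[K] K[X]) (h : kexp K (prho K br P) = kexp K (prho K br Q))
    (h0 : pev K M 0 P = pev K M 0 Q) : pev K M 1 P = pev K M 1 Q := by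
  have h1 := kexp_inj K (prho_nilp hL hN P) (prho_nilp hL hN Q) h
  refine pev_del K P Q ?_ h0
  have h2 := congrArg (fun f : Module.End K _ => (f (1, 0)).2) h1
  simpa [prho, affRep_apply] using h2

lemma pev_gbch (hL : LieBr K br) {N : ℕ} (hN : NilB K br N) (s : K) (u v) : pev K M s (gbch K (pbr K br) u v) = gbch K br (pev K M s u) (pev K M s v) :=
  map_gbch K (pev K M s) (pev_pbr K br s) (pbr_nil K hN) hN u v

lemma pev1 (a : M) : pev K M 1 (a ⊗ₜ X) = a := by simp [pev_tmul]
lemma pev0 (a : M) : pev K M 0 (a ⊗ₜ X) = 0 := by simp [pev_tmul]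

theorem gbch_assoc (hL : LieBr K br) {N : ℕ} (hN : NilB K br N) (a b c : M) :
    gbch K br (gbch K br a b) c = gbch K br a (gbch K br b c) := by
  have := prho_faith hL hN (gbch K (pbr K br) (gbch K (pbr K br) (a ⊗ₜ X) (b ⊗ₜ X)) (c ⊗ₜ X))
    (gbch K (pbr K br) (a ⊗ₜ X) (gbch K (pbr K br) (b ⊗ₜ X) (c ⊗ₜ X)))
    (by simp only [prho_bch hL hN, mul_assoc])
    (by simp only [pev_gbch hL hN, pev0, gbch_zero_zero K hN])
  simpa only [pev_gbch hL hN, pev1] using this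

theorem zero_gbch (hL : LieBr K br) {N : ℕ} (hN : NilB K br N) (a : M) : gbch K br 0 a = a := by
  have := prho_faith hL hN (gbch K (pbr K br) 0 (a ⊗ₜ X)) (a ⊗ₜ X)
    (by simp only [prho_bch hL hN, map_zero, kexp_zero, one_mul])
    (by simp only [pev_gbch hL hN, pev0, map_zero, gbch_zero_zero K hN])
  simpa only [pev_gbch hL hN, pev1, map_zero] using this

theorem gbch_zero (hL : LieBr K br) {N : ℕ} (hN : NilB K br N) (a : M) : gbch K br a 0 = a := by
  have := prho_faith hL hN (gbch K (pbr K br) (a ⊗ₜ X) 0) (a ⊗ₜ X)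
    (by simp only [prho_bch hL hN, map_zero, kexp_zero, mul_one])
    (by simp only [pev_gbch hL hN, pev0, map_zero, gbch_zero_zero K hN])
  simpa only [pev_gbch hL hN, pev1, map_zero] using this

theorem neg_gbch (hL : LieBr K br) {N : ℕ} (hN : NilB K br N) (a : M) : gbch K br (-a) a = 0 := by
  have := prho_faith hL hN (gbch K (pbr K br) (-(a ⊗ₜ X)) (a ⊗ₜ X)) 0
    (by simp only [prho_bch hL hN, map_zero, kexp_zero, map_neg, kexp_neg_mul K (prho_nilp hL hN _)])
    (by simp only [pev_gbch hL hN, pev0, map_zero, map_neg, neg_zero, gbch_zero_zero K hN])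
  simpa only [pev_gbch hL hN, pev1, map_zero, map_neg] using this

lemma kexp_conj (hL : LieBr K br) {N : ℕ} (hN : NilB K br N) {A : Type} [Ring A] [Algebra K A] {u v b : A} (huv : u * v = 1) (hvu : v * u = 1)
    (hb : IsNilpotent b) : kexp K (u * b * v) = u * kexp K b * v := by
  let U : Aˣ := ⟨u, v, huv, hvu⟩
  obtain ⟨k, hk⟩ := hb
  have hp : ∀ n, (u * b * v) ^ n = u * b ^ n * v := fun n => Units.conj_pow U b n
  rw [kexp_eq_sum K hk, kexp_eq_sum K (show (u * b * v) ^ k = 0 by rw [hp, hk]; simp)]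
  simp only [hp, Finset.mul_sum, Finset.sum_mul, mul_smul_comm, smul_mul_assoc]

theorem gbch_conj (hL : LieBr K br) {N : ℕ} (hN : NilB K br N) (a b : M) : gbch K br a (gbch K br b (-a)) = kexp K (br a) b := by
  have hnb : IsNilpotent (br a : Module.End K M) := ⟨N, hN.br_pow K a⟩
  have hnp : ∀ u, IsNilpotent (pbr K br u : Module.End K (M ⊗[K] K[X])) :=
    fun u => ⟨N, (pbr_nil K hN).br_pow K u⟩
  have hev : ∀ s : K, pev K M s (kexp K (pbr K br (a ⊗ₜ X)) (b ⊗ₜ X)) =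
      kexp K (br (pev K M s (a ⊗ₜ X))) (pev K M s (b ⊗ₜ X)) := fun s =>
    kexp_intertwine K (pev K M s) (hnp _) ⟨N, hN.br_pow K _⟩ (fun v => pev_pbr K br s _ v) _
  have hr : prho K br (kexp K (pbr K br (a ⊗ₜ X)) (b ⊗ₜ X)) =
      kexp K (prho K br (a ⊗ₜ X)) * prho K br (b ⊗ₜ X) * kexp K (-prho K br (a ⊗ₜ X)) := by
    rw [kexp_intertwine K (prho K br) (hnp _) ((expad_and_nilad K).2 _ (prho_nilp hL hN (a ⊗ₜ X)))
      (fun v => by rw [prho_lie hL hN]; rfl), (expad_and_nilad K).1 _ (prho_nilp hL hN (a ⊗ₜ X))]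
    simp [mul_assoc]
  have := prho_faith hL hN (gbch K (pbr K br) (a ⊗ₜ X) (gbch K (pbr K br) (b ⊗ₜ X) (-(a ⊗ₜ X))))
    (kexp K (pbr K br (a ⊗ₜ X)) (b ⊗ₜ X))
    (by
      rw [hr, kexp_conj hL hN (kexp_mul_neg K (prho_nilp hL hN _)) (kexp_neg_mul K (prho_nilp hL hN _))
        (prho_nilp hL hN _)]
      simp only [prho_bch hL hN, map_neg, mul_assoc])
    (by
      rw [hev]
      simp only [pev_gbch hL hN, pev0, map_zero, map_neg, neg_zero, gbch_zero_zero K hN])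
  rw [hev] at this
  simpa only [pev_gbch hL hN, pev1, map_neg] using this
end
end GroupLaw

set_option linter.all false

section DG
open Finset
variable {K : Type} [Field K] [CharZero K]

/-- Nilpotent DGLA (only what we need). -/
structure NDG (T : PreDGLA K) (N : ℕ) : Prop where
  d_sq : ∀ x, T.d (T.d x) = 0
  d_deg : ∀ i, ∀ x ∈ T.comp i, T.d x ∈ T.comp (i + 1)
  br_deg : ∀ i j, ∀ x ∈ T.comp i, ∀ y ∈ T.comp j, T.br x y ∈ T.comp (i + j)
  antisymm : ∀ i j, ∀ x ∈ T.comp i, ∀ y ∈ T.comp j,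
      T.br x y = -(PreDGLA.sgn (i * j) • T.br y x)
  jacobi : ∀ i j, ∀ x ∈ T.comp i, ∀ y ∈ T.comp j, ∀ z,
      T.br x (T.br y z) = T.br (T.br x y) z + PreDGLA.sgn (i * j) • T.br y (T.br x z)
  leibniz : ∀ i, ∀ x ∈ T.comp i, ∀ y,
      T.d (T.br x y) = T.br (T.d x) y + PreDGLA.sgn i • T.br x (T.d y)
  nil : NilB K T.br N

lemma mem_comp {L : PreDGLA K} {i : ℤ} {x : L.carrier} : x ∈ L.comp i ↔ L.proj i x = x := by
  rw [PreDGLA.comp, LinearMap.mem_ker, LinearMap.sub_apply, LinearMap.id_apply, sub_eq_zero]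

section tens
variable {L : PreDGLA K} {R : ArtinData K}

/-- Pure tensors. -/
def tp (L : PreDGLA K) (R : ArtinData K) (x : L.carrier) (q : R.mId) : (L.tmA R).carrier :=
  (x ⊗ₜ[K] q : L.carrier ⊗[K] R.mId)

lemma tp_ind {P : (L.tmA R).carrier → Prop} (h0 : P 0)
    (hadd : ∀ a b, P a → P b → P (a + b)) (ht : ∀ x q, P (tp L R x q))
    (x : (L.tmA R).carrier) : P x :=
  TensorProduct.induction_on (motive := P) x h0 ht hadd

lemma tp_add (x y : L.carrier) (q : R.mId) : tp L R (x + y) q = tp L R x q + tp L R y q :=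
  TensorProduct.add_tmul x y q

lemma tp_neg (x : L.carrier) (q : R.mId) : tp L R (-x) q = - tp L R x q :=
  TensorProduct.neg_tmul x q

lemma tp_zero (q : R.mId) : tp L R 0 q = 0 :=
  TensorProduct.zero_tmul _ q

lemma tp_zsmul (n : ℤ) (x : L.carrier) (q : R.mId) : tp L R (n • x) q = n • tp L R x q := by
  let f : L.carrier →+ (L.tmA R).carrier :=
    { toFun := fun x => tp L R x q, map_zero' := tp_zero q, map_add' := fun x y => tp_add x y q }
  exact map_zsmul f n x

lemma proj_tp (i : ℤ) (x : L.carrier) (q : R.mId) :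
    (L.tmA R).proj i (tp L R x q) = tp L R (L.proj i x) q := rfl

lemma tp_mem {i : ℤ} {x : L.carrier} (hx : x ∈ L.comp i) (q : R.mId) :
    tp L R x q ∈ (L.tmA R).comp i := by
  rw [mem_comp, proj_tp, mem_comp.mp hx]

lemma comp_ind (hL : L.IsDGLA) {i : ℤ} {P : (L.tmA R).carrier → Prop} (h0 : P 0)
    (hadd : ∀ a b, P a → P b → P (a + b)) (ht : ∀ x ∈ L.comp i, ∀ q, P (tp L R x q))
    (x : (L.tmA R).carrier) (hx : x ∈ (L.tmA R).comp i) : P x := by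
  rw [← mem_comp.mp hx]
  clear hx
  refine tp_ind (P := fun x => P ((L.tmA R).proj i x)) ?_ ?_ ?_ x
  · rw [map_zero]; exact h0
  · intro a b ha hb; rw [map_add]; exact hadd _ _ ha hb
  · intro a q
    rw [proj_tp]
    exact ht _ (mem_comp.mpr (hL.proj_idem i a)) q

lemma tmA_br (x y : L.carrier) (p q : R.mId) :
    (L.tmA R).br (tp L R x p) (tp L R y q) = tp L R (L.br x y) (R.mmul p q) :=
  tbr_tmul K L.br R.mmul x y p q

lemma tmA_d (x : L.carrier) (p : R.mId) : (L.tmA R).d (tp L R x p) = tp L R (L.d x) p :=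
  rfl

lemma mmul_comm (p q : R.mId) : R.mmul p q = R.mmul q p := Subtype.ext (mul_comm p.1 q.1)
lemma mmul_assoc (p q r : R.mId) : R.mmul p (R.mmul q r) = R.mmul (R.mmul p q) r :=
  Subtype.ext (mul_assoc p.1 q.1 r.1).symm
lemma mmul_lc (p q r : R.mId) : R.mmul p (R.mmul q r) = R.mmul q (R.mmul p r) :=
  Subtype.ext (mul_left_comm p.1 q.1 r.1)

theorem tmA_ndg (hL : L.IsDGLA) : ∃ N, NDG (L.tmA R) N := by
  obtain ⟨N, hN⟩ : ∃ N, (IsLocalRing.maximalIdeal R.A) ^ N = ⊥ := by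
    haveI := R.isArtinian
    have := IsArtinianRing.isNilpotent_jacobson_bot (R := R.A)
    rw [IsLocalRing.jacobson_eq_maximalIdeal _ bot_ne_top] at this
    exact this
  refine ⟨N, ?_, ?_, ?_, ?_, ?_, ?_, ?_⟩
  · intro x
    refine tp_ind (P := fun x => (L.tmA R).d ((L.tmA R).d x) = 0) ?_ ?_ ?_ x
    · rw [map_zero, map_zero]
    · intro a b ha hb; rw [map_add, map_add, ha, hb, add_zero]
    · intro a q; rw [tmA_d, tmA_d, hL.d_sq, tp_zero]
  · intro i x hx
    refine comp_ind (P := fun x => (L.tmA R).d x ∈ (L.tmA R).comp (i + 1)) hL ?_ ?_ ?_ x hx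
    · rw [map_zero]; exact Submodule.zero_mem _
    · intro a b ha hb; rw [map_add]; exact Submodule.add_mem _ ha hb
    · intro a ha q; rw [tmA_d]; exact tp_mem (hL.d_deg i a ha) q
  · intro i j x hx y hy
    refine comp_ind (P := fun x => (L.tmA R).br x y ∈ (L.tmA R).comp (i + j)) hL ?_ ?_ ?_ x hx
    · rw [map_zero]; exact Submodule.zero_mem _
    · intro a b ha hb; rw [map_add, LinearMap.add_apply]; exact Submodule.add_mem _ ha hb
    · intro a ha q
      refine comp_ind (P := fun y => (L.tmA R).br (tp L R a q) y ∈ (L.tmA R).comp (i + j))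
        hL ?_ ?_ ?_ y hy
      · rw [map_zero]; exact Submodule.zero_mem _
      · intro a b ha hb; rw [map_add]; exact Submodule.add_mem _ ha hb
      · intro b hb r; rw [tmA_br]; exact tp_mem (hL.br_deg i j a ha b hb) _
  · intro i j x hx y hy
    refine comp_ind (P := fun x => (L.tmA R).br x y = -(PreDGLA.sgn (i * j) • (L.tmA R).br y x))
      hL ?_ ?_ ?_ x hx
    · simp only [map_zero, LinearMap.zero_apply, smul_zero, neg_zero]
    · intro a b ha hb
      simp only [map_add, LinearMap.add_apply, ha, hb, smul_add, neg_add]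
    · intro a ha q
      refine comp_ind (P := fun y => (L.tmA R).br (tp L R a q) y =
        -(PreDGLA.sgn (i * j) • (L.tmA R).br y (tp L R a q))) hL ?_ ?_ ?_ y hy
      · simp only [map_zero, LinearMap.zero_apply, smul_zero, neg_zero]
      · intro a b ha hb
        simp only [map_add, LinearMap.add_apply, ha, hb, smul_add, neg_add]
      · intro b hb r
        rw [tmA_br, tmA_br, hL.antisymm i j a ha b hb, tp_neg, tp_zsmul, mmul_comm]
  · intro i j x hx y hy z
    refine comp_ind (P := fun x => (L.tmA R).br x ((L.tmA R).br y z) =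
      (L.tmA R).br ((L.tmA R).br x y) z + PreDGLA.sgn (i * j) • (L.tmA R).br y ((L.tmA R).br x z))
      hL ?_ ?_ ?_ x hx
    · simp only [map_zero, LinearMap.zero_apply, smul_zero, add_zero]
    · intro a b ha hb
      simp only [map_add, LinearMap.add_apply, ha, hb, smul_add]; abel
    · intro a ha q
      refine comp_ind (P := fun y => (L.tmA R).br (tp L R a q) ((L.tmA R).br y z) =
        (L.tmA R).br ((L.tmA R).br (tp L R a q) y) z +
          PreDGLA.sgn (i * j) • (L.tmA R).br y ((L.tmA R).br (tp L R a q) z)) hL ?_ ?_ ?_ y hy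
      · simp only [map_zero, LinearMap.zero_apply, smul_zero, add_zero]
      · intro a b ha hb
        simp only [map_add, LinearMap.add_apply, ha, hb, smul_add]; abel
      · intro b hb r
        refine tp_ind (P := fun z => (L.tmA R).br (tp L R a q) ((L.tmA R).br (tp L R b r) z) =
          (L.tmA R).br ((L.tmA R).br (tp L R a q) (tp L R b r)) z +
          PreDGLA.sgn (i * j) • (L.tmA R).br (tp L R b r) ((L.tmA R).br (tp L R a q) z)) ?_ ?_ ?_ z
        · simp only [map_zero, smul_zero, add_zero]
        · intro c e hc he; simp only [map_add, hc, he, smul_add]; abel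
        · intro c s
          simp only [tmA_br]
          rw [hL.jacobi i j a ha b hb c, tp_add, tp_zsmul, mmul_lc r, ← mmul_assoc]
  · intro i x hx y
    refine comp_ind (P := fun x => (L.tmA R).d ((L.tmA R).br x y) =
      (L.tmA R).br ((L.tmA R).d x) y + PreDGLA.sgn i • (L.tmA R).br x ((L.tmA R).d y)) hL ?_ ?_ ?_ x hx
    · simp only [map_zero, LinearMap.zero_apply, smul_zero, add_zero]
    · intro a b ha hb
      simp only [map_add, LinearMap.add_apply, ha, hb, smul_add]; abel
    · intro a ha q
      refine tp_ind (P := fun y => (L.tmA R).d ((L.tmA R).br (tp L R a q) y) =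
        (L.tmA R).br ((L.tmA R).d (tp L R a q)) y +
          PreDGLA.sgn i • (L.tmA R).br (tp L R a q) ((L.tmA R).d y)) ?_ ?_ ?_ y
      · simp only [map_zero, smul_zero, add_zero]
      · intro c e hc he; simp only [map_add, hc, he, smul_add]; abel
      · intro c s
        simp only [tmA_br, tmA_d]
        rw [hL.leibniz i a ha c, tp_add, tp_zsmul]
  · refine nil_tbr K L.br R.mmul (fun k x q => q.1 ∈ (IsLocalRing.maximalIdeal R.A) ^ k) ?_ ?_ ?_
    · intro x q; rw [pow_one]; exact q.2
    · intro k x q y r hr hk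
      rw [pow_succ']
      exact Ideal.mul_mem_mul q.2 hr
    · intro k x q hk hq
      have h1 := Ideal.pow_le_pow_right hk hq
      rw [hN] at h1
      have : q = 0 := Subtype.ext (by simpa using h1)
      rw [this, TensorProduct.tmul_zero]
end tens

lemma kexp_mem {V : Type} [AddCommGroup V] [Module K V] {f : Module.End K V} (hf : IsNilpotent f)
    (S : Submodule K V) (h : ∀ v ∈ S, f v ∈ S) {v : V} (hv : v ∈ S) : kexp K f v ∈ S := by
  obtain ⟨k, hk⟩ := hf
  rw [kexp_eq_sum K hk, LinearMap.sum_apply]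
  refine S.sum_mem fun i _ => S.smul_mem _ ?_
  rename_i hi
  clear hk hi
  induction i with
  | zero => simpa using hv
  | succ i ih => rw [pow_succ']; exact h _ ih

lemma nb_eq (T : PreDGLA K) (l : List T.carrier) : T.nb l = gnb K T.br l := by
  induction l with
  | nil => rfl
  | cons x l ih =>
    cases l with
    | nil => rfl
    | cons y l => rw [PreDGLA.nb, gnb, ih]

lemma bch_eq (T : PreDGLA K) (a b : T.carrier) : T.bch a b = gbch K T.br a b := by
  unfold PreDGLA.bch gbch
  refine finsum_congr fun p => ?_
  rw [nb_eq]
  congr 2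
  simp [PreDGLA.dynkinWord, dword, List.map_flatMap, sel]

lemma sgn_zero : PreDGLA.sgn 0 = 1 := by simp [PreDGLA.sgn]
lemma sgn_one : PreDGLA.sgn 1 = -1 := by simp [PreDGLA.sgn]
lemma sgn_neg_one : PreDGLA.sgn (-1) = -1 := by simp [PreDGLA.sgn]

namespace NDG
variable {T : PreDGLA K} {N : ℕ}

lemma jac0 (H : NDG T N) {a x : T.carrier} (ha : a ∈ T.comp 0) {j : ℤ} (hx : x ∈ T.comp j) (z : T.carrier) :
    T.br a (T.br x z) = T.br (T.br a x) z + T.br x (T.br a z) := by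
  rw [H.jacobi 0 j a ha x hx z, zero_mul, sgn_zero, one_smul]

lemma leib0 (H : NDG T N) {a : T.carrier} (ha : a ∈ T.comp 0) (z : T.carrier) :
    T.d (T.br a z) = T.br (T.d a) z + T.br a (T.d z) := by
  rw [H.leibniz 0 a ha z, sgn_zero, one_smul]

lemma br0 (H : NDG T N) {a x : T.carrier} (ha : a ∈ T.comp 0) {j : ℤ} (hx : x ∈ T.comp j) : T.br a x ∈ T.comp j := by
  simpa using H.br_deg 0 j a ha x hx

lemma d0 (H : NDG T N) {a : T.carrier} (ha : a ∈ T.comp 0) : T.d a ∈ T.comp 1 := by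
  simpa using H.d_deg 0 a ha

/-- restricted bracket -/
def nbr (H : NDG T N) : T.comp 0 →ₗ[K] T.comp 0 →ₗ[K] T.comp 0 :=
  LinearMap.mk₂ K (fun a b => ⟨T.br a b, H.br0 a.2 b.2⟩)
    (by intros; ext; simp) (by intros; ext; simp) (by intros; ext; simp) (by intros; ext; simp)

lemma nbr_coe (H : NDG T N) (a b : T.comp 0) : ((H.nbr a b : T.comp 0) : T.carrier) = T.br a b := rfl

lemma nbr_lie (H : NDG T N) : LieBr K H.nbr where
  anti x y := by
    ext
    have := H.antisymm 0 0 x x.2 y y.2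
    rw [zero_mul, sgn_zero, one_smul] at this
    simpa [nbr_coe] using this
  jac x y z := by
    ext
    simpa [nbr_coe] using H.jac0 x.2 y.2 z

lemma nbr_nil (H : NDG T N) : NilB K H.nbr N := by
  intro l hl
  have : ∀ l : List (T.comp 0), ((gnb K H.nbr l : T.comp 0) : T.carrier) =
      gnb K T.br (l.map (T.comp 0).subtype) := by
    intro l
    induction l with
    | nil => rfl
    | cons x l ih =>
      cases l with
      | nil => rfl
      | cons y l => rw [gnb, nbr_coe, ih]; rfl
  ext
  rw [this, H.nil _ (by simpa using hl)]; rfl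

lemma coe_bch (H : NDG T N) (a b : T.comp 0) : ((gbch K H.nbr a b : T.comp 0) : T.carrier) = T.bch a b := by
  rw [bch_eq]
  exact map_gbch K (T.comp 0).subtype (fun x y => rfl) H.nbr_nil H.nil a b

def act1 (H : NDG T N) : T.comp 0 →ₗ[K] Module.End K (T.comp 1) :=
  LinearMap.mk₂ K (fun a b => ⟨T.br a b, H.br0 a.2 b.2⟩)
    (by intros; ext; simp) (by intros; ext; simp) (by intros; ext; simp) (by intros; ext; simp)

lemma act1_coe (H : NDG T N) (a : T.comp 0) (x : T.comp 1) : ((H.act1 a x : T.comp 1) : T.carrier) = T.br a x := rfl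

def c1 (H : NDG T N) : T.comp 0 →ₗ[K] T.comp 1 where
  toFun a := ⟨T.d a, H.d0 a.2⟩
  map_add' := by intros; ext; simp
  map_smul' := by intros; ext; simp

lemma c1_coe (H : NDG T N) (a : T.comp 0) : ((H.c1 a : T.comp 1) : T.carrier) = T.d a := rfl

def aff (H : NDG T N) : T.comp 0 →ₗ[K] Module.End K (K × T.comp 1) := affRep K H.act1 H.c1

lemma act1_lie (H : NDG T N) (x y : T.comp 0) : H.act1 (H.nbr x y) = H.act1 x * H.act1 y - H.act1 y * H.act1 x := by
  refine LinearMap.ext fun z => ?_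
  ext
  simp only [LinearMap.sub_apply, Module.End.mul_apply, act1_coe, nbr_coe, AddSubgroupClass.coe_sub]
  rw [H.jac0 x.2 y.2 z]; abel

lemma c1_lie (H : NDG T N) (x y : T.comp 0) : H.c1 (H.nbr x y) = H.act1 x (H.c1 y) - H.act1 y (H.c1 x) := by
  ext
  simp only [act1_coe, nbr_coe, c1_coe, AddSubgroupClass.coe_sub]
  rw [H.leib0 x.2, H.antisymm 1 0 _ (H.d0 x.2) _ y.2, mul_zero, sgn_zero, one_smul]; abel

lemma act1_list (H : NDG T N) (l : List (T.comp 0)) (z : T.comp 1) : (((l.map H.act1).prod z : T.comp 1) : T.carrier) =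
    ((l.map (T.comp 0).subtype).map (fun x => (T.br x : Module.End K T.carrier))).prod z := by
  induction l with
  | nil => simp
  | cons x l ih =>
    simp only [List.map_cons, List.prod_cons, Module.End.mul_apply, act1_coe, ih]
    rfl

lemma act1_prod (H : NDG T N) (l : List (T.comp 0)) (hl : N ≤ l.length) : (l.map H.act1).prod = 0 := by
  refine LinearMap.ext fun z => ?_
  ext
  rw [act1_list, H.nil.prod_eq_zero K _ (by simpa using hl)]; rfl

lemma aff_nilp (H : NDG T N) (a : T.comp 0) : IsNilpotent (H.aff a) :=
  ⟨N + 1, affRep_nilp K _ _ H.act1_prod a⟩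

lemma aff_bch (H : NDG T N) (a b : T.comp 0) : kexp K (H.aff (gbch K H.nbr a b)) = kexp K (H.aff a) * kexp K (H.aff b) :=
  rep_bch K H.aff (affRep_lie K _ _ H.act1_lie H.c1_lie) H.nbr_nil
    (affRep_prod K _ _ H.act1_prod) a b

/-- gauge action on degree one elements -/
def ga (H : NDG T N) (a : T.comp 0) (x : T.comp 1) : T.comp 1 := (kexp K (H.aff a) (1, x)).2

lemma kexp_aff (H : NDG T N) (a : T.comp 0) (x : T.comp 1) : kexp K (H.aff a) (1, x) = (1, H.ga a x) := by
  have := kexp_affRep K H.act1 H.c1 H.act1_prod a x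
  ext1
  · exact (congrArg Prod.fst this :)
  · rfl

lemma ga_coe (H : NDG T N) (a : T.comp 0) (x : T.comp 1) : ((H.ga a x : T.comp 1) : T.carrier) = T.gauge a x := by
  have := congrArg Prod.snd (kexp_affRep K H.act1 H.c1 H.act1_prod a x)
  have h2 : ∀ (n : ℕ) (z : T.comp 1), (((H.act1 a ^ n) z : T.comp 1) : T.carrier) = (T.br (a : T.carrier) ^ n) z := by
    intro n z
    have := H.act1_list (List.replicate n a) z
    simpa using this
  change H.ga a x = _ at this
  rw [this, PreDGLA.gauge]
  rw [finsum_eq_sum_of_support_subset (s := range N)]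
  · simp only [Submodule.coe_add, AddSubmonoidClass.coe_finset_sum, Submodule.coe_smul, h2,
      AddSubgroupClass.coe_sub, act1_coe, c1_coe]
  · intro n hn
    rw [Function.mem_support] at hn
    simp only [coe_range, Set.mem_Iio]
    by_contra hlt
    apply hn
    rw [pow_eq_zero_of_le (not_lt.mp hlt) (H.nil.br_pow K a)]; simp

lemma ga_bch (H : NDG T N) (a b : T.comp 0) (x : T.comp 1) : H.ga (gbch K H.nbr a b) x = H.ga a (H.ga b x) := by
  have h := congrArg (fun f : Module.End K (K × T.comp 1) => f (1, x)) (H.aff_bch a b)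
  simp only [Module.End.mul_apply, kexp_aff] at h
  exact (congrArg Prod.snd h :)

lemma ga_zero (H : NDG T N) (x : T.comp 1) : H.ga 0 x = x := by
  rw [ga, map_zero, kexp_zero]; rfl

lemma ad_nilp (H : NDG T N) (a : T.carrier) : IsNilpotent (T.br a : Module.End K T.carrier) := ⟨N, H.nil.br_pow K a⟩

/-- the twisted differential as a bilinear map -/
def tw (H : NDG T N) : (K × T.comp 1) →ₗ[K] T.carrier →ₗ[K] T.carrier :=
  LinearMap.mk₂ K (fun v h => v.1 • T.d h + T.br v.2 h)
    (by intros; simp [add_smul]; abel) (by intros; simp [mul_smul])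
    (by intros; simp; abel) (by intros; simp; rw [smul_comm])

lemma tw_apply (H : NDG T N) (v : K × T.comp 1) (h : T.carrier) : H.tw v h = v.1 • T.d h + T.br v.2 h := rfl

lemma tw_der (H : NDG T N) (a : T.comp 0) (v : K × T.comp 1) (h : T.carrier) :
    T.br a (H.tw v h) = H.tw (H.aff a v) h + H.tw v (T.br a h) := by
  simp only [tw_apply, aff, affRep_apply, zero_smul, zero_add, AddSubgroupClass.coe_sub, act1_coe,
    Submodule.coe_smul, c1_coe, map_add, map_smul, map_sub, LinearMap.sub_apply, LinearMap.smul_apply]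
  rw [H.jac0 a.2 v.2.2, H.leib0 a.2, smul_add]; abel

lemma exp_tw (H : NDG T N) (a : T.comp 0) (x : T.comp 1) (h : T.carrier) :
    kexp K (T.br a) (T.d h + T.br x h) =
      T.d (kexp K (T.br a) h) + T.br (H.ga a x) (kexp K (T.br a) h) := by
  have := kexp_bilin K H.tw (H.aff_nilp a) (H.ad_nilp a) (H.ad_nilp a) (H.tw_der a) (1, x) h
  rw [kexp_aff] at this
  simpa [tw_apply] using this

/-- polarized curvature -/
def cur (H : NDG T N) : (K × T.comp 1) →ₗ[K] (K × T.comp 1) →ₗ[K] T.carrier :=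
  LinearMap.mk₂ K (fun v w => v.1 • T.d w.2 + w.1 • T.d v.2 + T.br v.2 w.2)
    (by intros; simp [add_smul]; abel) (by intros; simp [mul_smul, smul_add]; rw [smul_comm])
    (by intros; simp [add_smul]; abel) (by intros; simp [mul_smul, smul_add]; rw [smul_comm])

lemma cur_apply (H : NDG T N) (v w : K × T.comp 1) :
    H.cur v w = v.1 • T.d w.2 + w.1 • T.d v.2 + T.br v.2 w.2 := rfl

lemma cur_der (H : NDG T N) (a : T.comp 0) (v w : K × T.comp 1) :
    T.br a (H.cur v w) = H.cur (H.aff a v) w + H.cur v (H.aff a w) := by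
  simp only [cur_apply, aff, affRep_apply, zero_smul, zero_add, add_zero, AddSubgroupClass.coe_sub,
    act1_coe, Submodule.coe_smul, c1_coe, map_add, map_smul, map_sub, LinearMap.sub_apply,
    LinearMap.smul_apply, H.d_sq, smul_zero, sub_zero]
  rw [H.jac0 a.2 v.2.2, H.leib0 a.2, H.leib0 a.2, H.antisymm 1 1 _ v.2.2 _ (H.d0 a.2), mul_one, sgn_one]
  simp only [smul_add, neg_smul, one_smul, neg_neg]
  abel

lemma mc_iff (H : NDG T N) (x : T.comp 1) : (x : T.carrier) ∈ T.MCset ↔ H.cur (1, x) (1, x) = 0 := by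
  have : H.cur (1, x) (1, x) = (2 : K) • (T.d x + (2 : K)⁻¹ • T.br x x) := by
    rw [cur_apply, smul_add, smul_smul, mul_inv_cancel₀ two_ne_zero, two_smul]; simp
  rw [this, smul_eq_zero_iff_right two_ne_zero]
  exact ⟨fun h => h.2, fun h => ⟨x.2, h⟩⟩

lemma ga_mc (H : NDG T N) (a : T.comp 0) {x : T.comp 1} (hx : (x : T.carrier) ∈ T.MCset) :
    (H.ga a x : T.carrier) ∈ T.MCset := by
  rw [H.mc_iff] at hx ⊢
  have := kexp_bilin K H.cur (H.aff_nilp a) (H.aff_nilp a) (H.ad_nilp a) (H.cur_der a) (1, x) (1, x)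
  rw [hx, map_zero, kexp_aff] at this
  exact this.symm

lemma D_sq (H : NDG T N) {x : T.carrier} (hx : x ∈ T.MCset) (h : T.carrier) :
    T.d (T.d h + T.br x h) + T.br x (T.d h + T.br x h) = 0 := by
  obtain ⟨h1, h2⟩ := hx
  have hj := H.jacobi 1 1 x h1 x h1 h
  rw [mul_one, sgn_one, neg_smul, one_smul] at hj
  have hj2 : T.br x (T.br x h) = (2 : K)⁻¹ • T.br (T.br x x) h := by
    rw [eq_inv_smul_iff₀ two_ne_zero, two_smul]
    nth_rewrite 1 [hj]; abel
  rw [map_add, map_add, H.d_sq, H.leibniz 1 x h1, sgn_one, neg_smul, one_smul, hj2]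
  have h3 := congrArg (fun y => T.br y h) h2
  simp only [map_add, map_smul, LinearMap.add_apply, LinearMap.smul_apply, map_zero, LinearMap.zero_apply] at h3
  refine Eq.trans ?_ h3; abel

lemma D_deg (H : NDG T N) {x h : T.carrier} (hx : x ∈ T.comp 1) (hh : h ∈ T.comp (-1)) :
    T.d h + T.br x h ∈ T.comp 0 := by
  have h1 := H.d_deg _ h hh
  have h2 := H.br_deg _ _ x hx h hh
  norm_num at h1 h2
  exact Submodule.add_mem _ h1 h2

lemma D_br (H : NDG T N) {x h : T.carrier} (hx : x ∈ T.comp 1) (hh : h ∈ T.comp (-1)) (u : T.carrier) :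
    T.d (T.br h u) + T.br x (T.br h u) = T.br (T.d h + T.br x h) u - T.br h (T.d u + T.br x u) := by
  rw [H.leibniz _ h hh, H.jacobi _ _ x hx h hh]
  norm_num [sgn_neg_one]
  abel

def stab (H : NDG T N) {x : T.carrier} (hx : x ∈ T.MCset) : Submodule K (T.comp 0) where
  carrier := {s | (s : T.carrier) ∈ T.Stab x}
  zero_mem' := ⟨0, Submodule.zero_mem _, by simp⟩
  add_mem' := by
    rintro a b ⟨h, hh, e⟩ ⟨h', hh', e'⟩
    exact ⟨h + h', Submodule.add_mem _ hh hh', by simp [e, e']; abel⟩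
  smul_mem' := by
    rintro c a ⟨h, hh, e⟩
    exact ⟨c • h, Submodule.smul_mem _ _ hh, by simp [e]⟩

lemma stab_br (H : NDG T N) {x : T.carrier} (hx : x ∈ T.MCset) (s) (hs : s ∈ H.stab hx) (t) (ht : t ∈ H.stab hx) :
    H.nbr s t ∈ H.stab hx := by
  obtain ⟨h, hh, e⟩ := hs
  obtain ⟨k, hk, e'⟩ := ht
  refine ⟨T.br h t, ?_, ?_⟩
  · simpa using H.br_deg _ _ h hh t t.2
  · rw [H.D_br hx.1 hh, e', H.D_sq hx, map_zero, sub_zero, ← e, ← e', nbr_coe]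

lemma stab_bch (H : NDG T N) {x : T.carrier} (hx : x ∈ T.MCset) {s t} (hs : s ∈ H.stab hx) (ht : t ∈ H.stab hx) :
    gbch K H.nbr s t ∈ H.stab hx :=
  gbch_mem K H.nbr_nil (H.stab hx) (fun s hs t ht => H.stab_br hx s hs t ht) hs ht

lemma stab_ga (H : NDG T N) {x : T.comp 1} (hx : (x : T.carrier) ∈ T.MCset) {s} (hs : s ∈ H.stab hx) : H.ga s x = x := by
  obtain ⟨h, hh, e⟩ := hs
  have : H.act1 s x - H.c1 s = 0 := by
    ext
    simp only [AddSubgroupClass.coe_sub, act1_coe, c1_coe, ZeroMemClass.coe_zero]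
    rw [H.antisymm 0 1 _ s.2 _ x.2, zero_mul, sgn_zero, one_smul]
    have := H.D_sq hx h
    rw [← e] at this
    rw [← neg_eq_zero, ← this]; abel
  have h2 := congrArg Prod.snd (kexp_affRep K H.act1 H.c1 H.act1_prod s x)
  rw [this] at h2
  simp only [map_zero, smul_zero, Finset.sum_const_zero, add_zero] at h2
  exact h2

lemma stab_conj (H : NDG T N) {x : T.comp 1} (hx : (x : T.carrier) ∈ T.MCset) (a : T.comp 0) {s} (hs : s ∈ H.stab hx) :
    gbch K H.nbr a (gbch K H.nbr s (-a)) ∈ H.stab (H.ga_mc a hx) := by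
  rw [gbch_conj H.nbr_lie H.nbr_nil]
  obtain ⟨h, hh, e⟩ := hs
  refine ⟨kexp K (T.br a) h, kexp_mem (H.ad_nilp a) _ (fun v hv => H.br0 a.2 hv) hh, ?_⟩
  rw [← H.exp_tw, ← e]
  exact kexp_intertwine K (T.comp 0).subtype ⟨N, H.nbr_nil.br_pow K a⟩ (H.ad_nilp a) (fun v => rfl) s

end NDG
end DG

set_option linter.all false

section Final
variable {K : Type} [Field K] [CharZero K]

/-- The exponential group of degree zero elements. -/
def GN {T : PreDGLA K} {N : ℕ} (H : NDG T N) : Type := T.comp 0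

namespace GN
variable {T : PreDGLA K} {N : ℕ} {H : NDG T N}

instance : Mul (GN H) := ⟨fun a b => (gbch K H.nbr a b : T.comp 0)⟩
instance : One (GN H) := ⟨(0 : T.comp 0)⟩
instance : Inv (GN H) := ⟨fun a => (-(show T.comp 0 from a) : T.comp 0)⟩

instance : Group (GN H) := Group.ofLeftAxioms
  (fun a b c => gbch_assoc H.nbr_lie H.nbr_nil a b c)
  (fun a => zero_gbch H.nbr_lie H.nbr_nil a)
  (fun a => neg_gbch H.nbr_lie H.nbr_nil a)

/-- underlying element -/
def val (a : GN H) : T.carrier := ((show T.comp 0 from a) : T.carrier)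

def mk (H : NDG T N) (x : T.carrier) (hx : x ∈ T.comp 0) : GN H := (⟨x, hx⟩ : T.comp 0)

lemma val_mem (a : GN H) : a.val ∈ T.comp 0 := Subtype.property (show T.comp 0 from a)
lemma val_mk (x : T.carrier) (hx : x ∈ T.comp 0) : (mk H x hx).val = x := rfl
lemma ext {a b : GN H} (h : a.val = b.val) : a = b := Subtype.ext h
lemma val_mul (a b : GN H) : (a * b).val = T.bch a.val b.val := H.coe_bch a b
lemma val_inv (a : GN H) : (a⁻¹).val = - a.val := rfl
lemma val_one : (1 : GN H).val = 0 := rfl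

/-- gauge action -/
def ga (a : GN H) (x : T.comp 1) : T.comp 1 := H.ga (show T.comp 0 from a) x

lemma ga_coe (a : GN H) (x : T.comp 1) : ((ga a x : T.comp 1) : T.carrier) = T.gauge a.val x :=
  H.ga_coe _ x
lemma ga_mul (a b : GN H) (x : T.comp 1) : ga (a * b) x = ga a (ga b x) := H.ga_bch _ _ x
lemma ga_one (x : T.comp 1) : ga (1 : GN H) x = x := H.ga_zero x

def MC (x : T.comp 1) : Prop := (x : T.carrier) ∈ T.MCset
lemma ga_mc (a : GN H) {x : T.comp 1} (hx : MC x) : MC (ga a x) := H.ga_mc _ hx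

/-- irrelevant stabilizer -/
def St (x : T.comp 1) (s : GN H) : Prop := s.val ∈ T.Stab x

lemma st_mul {x : T.comp 1} (hx : MC x) {s t : GN H} (hs : St x s) (ht : St x t) : St x (s * t) :=
  H.stab_bch hx hs ht
lemma st_inv {x : T.comp 1} (hx : MC x) {s : GN H} (hs : St x s) : St x s⁻¹ :=
  (H.stab hx).neg_mem hs
lemma st_one {x : T.comp 1} (hx : MC x) : St x (1 : GN H) :=
  (H.stab hx).zero_mem
lemma st_ga {x : T.comp 1} (hx : MC x) {s : GN H} (hs : St x s) : ga s x = x :=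
  H.stab_ga hx hs
lemma st_conj {x : T.comp 1} (hx : MC x) (a : GN H) {s : GN H} (hs : St x s) :
    St (ga a x) (a * s * a⁻¹) := by
  rw [mul_assoc]
  exact H.stab_conj hx _ hs
lemma ga_inv {a : GN H} {x y : T.comp 1} (h : ga a x = y) : ga a⁻¹ y = x := by
  rw [← h, ← ga_mul, inv_mul_cancel, ga_one]

end GN

/-- Morphisms of DGLAs, unbundled. -/
structure FM (T T' : PreDGLA K) (f : T.carrier →ₗ[K] T'.carrier) : Prop where
  br : ∀ x y, f (T.br x y) = T'.br (f x) (f y)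
  d : ∀ x, f (T.d x) = T'.d (f x)
  comp : ∀ i, ∀ x ∈ T.comp i, f x ∈ T'.comp i

namespace FM
open GN
variable {T T' : PreDGLA K} {N N' : ℕ} {H : NDG T N} {H' : NDG T' N'} {f : T.carrier →ₗ[K] T'.carrier}

def f1 (F : FM T T' f) : T.comp 1 →ₗ[K] T'.comp 1 := f.restrict (F.comp 1)

lemma f1_coe (F : FM T T' f) (x : T.comp 1) : ((F.f1 x : T'.comp 1) : T'.carrier) = f x := rfl

def fG (F : FM T T' f) (H : NDG T N) (H' : NDG T' N') : GN H →* GN H' :=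
  MonoidHom.mk' (fun a => GN.mk H' (f a.val) (F.comp 0 _ a.val_mem)) (by
    intro a b
    apply GN.ext
    change f (a * b).val = (GN.mk H' (f a.val) _ * GN.mk H' (f b.val) _).val
    rw [val_mul, val_mul, val_mk, val_mk, bch_eq, bch_eq]
    exact map_gbch K f F.br H.nil H'.nil _ _)

lemma fG_val (F : FM T T' f) (a : GN H) : (F.fG H H' a).val = f a.val := rfl

lemma f1_mc (F : FM T T' f) {x : T.comp 1} (hx : MC x) : MC (F.f1 x) := by
  refine ⟨(F.f1 x).2, ?_⟩
  rw [f1_coe, ← F.d, ← F.br, ← map_smul, ← map_add, hx.2, map_zero]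

lemma f1_ga_aux (F : FM T T' f) (H : NDG T N) (H' : NDG T' N') (a : T.comp 0) (b : T'.comp 0)
    (hb : (b : T'.carrier) = f a) (x : T.comp 1) : F.f1 (H.ga a x) = H'.ga b (F.f1 x) := by
  have := kexp_intertwine K (LinearMap.prodMap (LinearMap.id : K →ₗ[K] K) F.f1)
    (H.aff_nilp a) (H'.aff_nilp b) (by
      intro v
      simp only [NDG.aff, affRep_apply, LinearMap.prodMap_apply, LinearMap.id_apply, map_sub, map_smul]
      ext
      · rfl
      · simp only [AddSubgroupClass.coe_sub, Submodule.coe_smul, f1_coe, NDG.act1_coe, NDG.c1_coe]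
        rw [F.br, F.d, hb]) (1, x)
  exact (congrArg Prod.snd this :)

lemma f1_ga (F : FM T T' f) (a : GN H) (x : T.comp 1) :
    F.f1 (ga a x) = ga (F.fG H H' a) (F.f1 x) :=
  F.f1_ga_aux H H' _ _ rfl x

lemma f1_st (F : FM T T' f) {x : T.comp 1} {s : GN H} (hs : St x s) :
    St (F.f1 x) (F.fG H H' s) := by
  obtain ⟨h, hh, e⟩ := hs
  exact ⟨f h, F.comp _ h hh, by rw [fG_val, e, map_add, F.d, F.br, f1_coe]⟩
end FM

lemma faceT_fm (G : ScDGLA K) (R : ArtinData K) (n : ℕ) (k : Fin (n + 2)) :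
    FM ((G.g n).tmA R) ((G.g (n + 1)).tmA R) (G.faceT R n k) := by
  have htp : ∀ x q, G.faceT R n k (tp (G.g n) R x q) = tp (G.g (n + 1)) R ((G.face n k).lin x) q :=
    fun x q => rfl
  refine ⟨?_, ?_, ?_⟩
  · intro x y
    refine tp_ind (P := fun x => G.faceT R n k (((G.g n).tmA R).br x y) =
      ((G.g (n + 1)).tmA R).br (G.faceT R n k x) (G.faceT R n k y)) ?_ ?_ ?_ x
    · simp only [map_zero, LinearMap.zero_apply]
    · intro a b ha hb; simp only [map_add, LinearMap.add_apply, ha, hb]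
    · intro a q
      refine tp_ind (P := fun y => G.faceT R n k (((G.g n).tmA R).br (tp (G.g n) R a q) y) =
        ((G.g (n + 1)).tmA R).br (G.faceT R n k (tp (G.g n) R a q)) (G.faceT R n k y)) ?_ ?_ ?_ y
      · simp only [map_zero]
      · intro a b ha hb; simp only [map_add, ha, hb]
      · intro b r; rw [tmA_br, htp, htp, htp, tmA_br, (G.face n k).map_br]
  · intro x
    refine tp_ind (P := fun x => G.faceT R n k (((G.g n).tmA R).d x) =
      ((G.g (n + 1)).tmA R).d (G.faceT R n k x)) ?_ ?_ ?_ x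
    · simp only [map_zero]
    · intro a b ha hb; simp only [map_add, ha, hb]
    · intro a q; rw [tmA_d, htp, htp, tmA_d, (G.face n k).map_d]
  · intro i x hx
    refine comp_ind (P := fun x => G.faceT R n k x ∈ ((G.g (n + 1)).tmA R).comp i)
      (G.isDGLA n) ?_ ?_ ?_ x hx
    · rw [map_zero]; exact Submodule.zero_mem _
    · intro a b ha hb; rw [map_add]; exact Submodule.add_mem _ ha hb
    · intro a ha q
      rw [htp]
      refine tp_mem (mem_comp.mpr ?_) q
      rw [← (G.face n k).map_proj, mem_comp.mp ha]

lemma faceT_comm (G : ScDGLA K) (R : ArtinData K) (n : ℕ) (k l : Fin (n + 2)) (h : (l : ℕ) ≤ k) (x) :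
    G.faceT R (n + 1) k.succ (G.faceT R n l x) = G.faceT R (n + 1) l.castSucc (G.faceT R n k x) := by
  have htp : ∀ n k x q, G.faceT R n k (tp (G.g n) R x q) = tp (G.g (n + 1)) R ((G.face n k).lin x) q :=
    fun n k x q => rfl
  refine tp_ind (P := fun x => G.faceT R (n + 1) k.succ (G.faceT R n l x) =
    G.faceT R (n + 1) l.castSucc (G.faceT R n k x)) ?_ ?_ ?_ x
  · simp only [map_zero]
  · intro a b ha hb; simp only [map_add, ha, hb]
  · intro a q; rw [htp, htp, htp, htp, G.face_comm n k l h]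

open GN

theorem abs_main {T0 T1 T2 : PreDGLA K} {N0 N1 N2 : ℕ} (H0 : NDG T0 N0) (H1 : NDG T1 N1)
    (H2 : NDG T2 N2) {d0 d1 : T0.carrier →ₗ[K] T1.carrier} {e0 e1 e2 : T1.carrier →ₗ[K] T2.carrier}
    (D0 : FM T0 T1 d0) (D1 : FM T0 T1 d1) (E0 : FM T1 T2 e0) (E1 : FM T1 T2 e1) (E2 : FM T1 T2 e2)
    (c10 : ∀ x, e1 (d0 x) = e0 (d0 x)) (c20 : ∀ x, e2 (d0 x) = e0 (d1 x))
    (c21 : ∀ x, e2 (d1 x) = e1 (d1 x)) 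
    (Z : T0.comp 1 → GN H1 → Prop)
    (hZ : ∀ x m, Z x m ↔ MC x ∧ D1.f1 x = ga m (D0.f1 x) ∧
      St (E2.f1 (D0.f1 x)) (E0.fG H1 H2 m * ((E1.fG H1 H2 m)⁻¹ * E2.fG H1 H2 m)))
    (Rl : T0.comp 1 → GN H1 → T0.comp 1 → GN H1 → Prop)
    (hR : ∀ x m y n, Rl x m y n ↔ ∃ a : GN H0, ga a x = y ∧
      St (D0.f1 x) (m⁻¹ * ((D1.fG H0 H1 a)⁻¹ * (n * D0.fG H0 H1 a)))) :
    (∀ x m, Z x m → Rl x m x m) ∧ (∀ x m y n, Z x m → Rl x m y n → Rl y n x m) ∧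
    (∀ x m y n z p, Z x m → Rl x m y n → Rl y n z p → Rl x m z p) ∧
    (∀ x m y n, Z x m → Rl x m y n → Z y n) := by
  have C10 : ∀ a : GN H0, E1.fG H1 H2 (D0.fG H0 H1 a) = E0.fG H1 H2 (D0.fG H0 H1 a) :=
    fun a => GN.ext (c10 _)
  have C20 : ∀ a : GN H0, E2.fG H1 H2 (D0.fG H0 H1 a) = E0.fG H1 H2 (D1.fG H0 H1 a) :=
    fun a => GN.ext (c20 _)
  have C21 : ∀ a : GN H0, E2.fG H1 H2 (D1.fG H0 H1 a) = E1.fG H1 H2 (D1.fG H0 H1 a) :=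
    fun a => GN.ext (c21 _)
  have c10' : ∀ x, E1.f1 (D0.f1 x) = E0.f1 (D0.f1 x) := fun x => Subtype.ext (c10 _)
  have c20' : ∀ x, E2.f1 (D0.f1 x) = E0.f1 (D1.f1 x) := fun x => Subtype.ext (c20 _)
  refine ⟨?_, ?_, ?_, ?_⟩
  · intro x m h
    obtain ⟨hx, -, -⟩ := (hZ x m).mp h
    refine (hR _ _ _ _).mpr ⟨1, ga_one x, ?_⟩
    simpa using st_one (H := H1) (D0.f1_mc hx)
  · intro x m y n h hr
    obtain ⟨hx, -, -⟩ := (hZ x m).mp h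
    obtain ⟨a, rfl, hs⟩ := (hR _ _ _ _).mp hr
    refine (hR _ _ _ _).mpr ⟨a⁻¹, ga_inv rfl, ?_⟩
    rw [D0.f1_ga (H' := H1)]
    have := st_conj (D0.f1_mc hx) (D0.fG H0 H1 a) (st_inv (D0.f1_mc hx) hs)
    convert this using 1
    simp only [map_inv]
    group
  · intro x m y n z p h hr hr'
    obtain ⟨hx, -, -⟩ := (hZ x m).mp h
    obtain ⟨a, rfl, hs⟩ := (hR _ _ _ _).mp hr
    obtain ⟨b, rfl, hs'⟩ := (hR _ _ _ _).mp hr'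
    refine (hR _ _ _ _).mpr ⟨b * a, ga_mul b a x, ?_⟩
    have h1 := st_conj (D0.f1_mc (ga_mc a hx)) (D0.fG H0 H1 a)⁻¹ hs'
    rw [ga_inv (D0.f1_ga (H' := H1) a x).symm] at h1
    have := st_mul (D0.f1_mc hx) hs h1
    convert this using 1
    simp only [map_mul]
    group
  · intro x m y n h hr
    obtain ⟨hx, hm, hc⟩ := (hZ x m).mp h
    obtain ⟨a, rfl, hs⟩ := (hR _ _ _ _).mp hr
    have hx0 := D0.f1_mc hx
    have hx20 := E2.f1_mc hx0
    generalize hsd : m⁻¹ * ((D1.fG H0 H1 a)⁻¹ * (n * D0.fG H0 H1 a)) = s at hs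
    have hn : n = D1.fG H0 H1 a * m * s * (D0.fG H0 H1 a)⁻¹ := by
      rw [← hsd]; group
    refine (hZ _ _).mpr ⟨ga_mc a hx, ?_, ?_⟩
    · rw [D0.f1_ga (H' := H1), D1.f1_ga (H' := H1), hn, ga_mul, ga_inv rfl, ga_mul, st_ga hx0 hs,
        ga_mul, hm]
    · rw [D0.f1_ga (H' := H1), E2.f1_ga (H' := H2)]
      have k0 := E0.f1_st (H' := H2) hs
      have k1 := E1.f1_st (H' := H2) hs
      have k2 := E2.f1_st (H' := H2) hs
      rw [c10'] at k1
      have kk := st_conj (E0.f1_mc hx0) (E0.fG H1 H2 m) (st_mul (E0.f1_mc hx0) k0 (st_inv (E0.f1_mc hx0) k1))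
      rw [← E0.f1_ga, ← hm, ← c20'] at kk
      have := st_conj hx20 (E2.fG H1 H2 (D0.fG H0 H1 a)) (st_mul hx20 (st_mul hx20 kk hc) k2)
      convert this using 1
      rw [hn]
      simp only [map_mul, map_inv, C10, C21, C20]
      group

end Final

/-- For a semicosimplicial DGLA `g^Δ` over `K` and `A ∈ Art_K`,
the relation `∼` is an equivalence relation on `Z¹_sc(exp g^Δ)(A)`, and
`Z¹_sc(exp g^Δ)(A)` is closed under `∼`: if `(l₀,m₀) ∈ Z¹_sc(exp g^Δ)(A)` and
`(l₁,m₁) ∈ (g_0¹ ⊕ g_1⁰) ⊗ m_A` is related to it, then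
`(l₁,m₁) ∈ Z¹_sc(exp g^Δ)(A)`. -/
theorem srel_is_equivalence_and_Zsc_closed
    {K : Type} [Field K] [CharZero K] (G : ScDGLA K) (R : ArtinData K) :
    (∀ p ∈ G.Zsc R, G.srel R p p) ∧
    (∀ p q, p ∈ G.Zsc R → q ∈ G.Zsc R → G.srel R p q → G.srel R q p) ∧
    (∀ p q r, p ∈ G.Zsc R → q ∈ G.Zsc R → r ∈ G.Zsc R →
      G.srel R p q → G.srel R q r → G.srel R p r) ∧
    (∀ p q, p ∈ G.Zsc R →
      q.1 ∈ ((G.g 0).tmA R).comp 1 → q.2 ∈ ((G.g 1).tmA R).comp 0 →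
      G.srel R p q → q ∈ G.Zsc R) := by
  obtain ⟨N0, H0⟩ := tmA_ndg (R := R) (G.isDGLA 0)
  obtain ⟨N1, H1⟩ := tmA_ndg (R := R) (G.isDGLA 1)
  obtain ⟨N2, H2⟩ := tmA_ndg (R := R) (G.isDGLA 2)
  have D0 : FM ((G.g 0).tmA R) ((G.g 1).tmA R) (G.faceT R 0 0) := faceT_fm G R 0 0
  have D1 : FM ((G.g 0).tmA R) ((G.g 1).tmA R) (G.faceT R 0 1) := faceT_fm G R 0 1
  have E0 : FM ((G.g 1).tmA R) ((G.g 2).tmA R) (G.faceT R 1 0) := faceT_fm G R 1 0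
  have E1 : FM ((G.g 1).tmA R) ((G.g 2).tmA R) (G.faceT R 1 1) := faceT_fm G R 1 1
  have E2 : FM ((G.g 1).tmA R) ((G.g 2).tmA R) (G.faceT R 1 2) := faceT_fm G R 1 2
  have hZ : ∀ (x : ((G.g 0).tmA R).comp 1) (m : GN H1),
      ((x : ((G.g 0).tmA R).carrier), m.val) ∈ G.Zsc R ↔
      GN.MC x ∧ D1.f1 x = GN.ga m (D0.f1 x) ∧
      GN.St (E2.f1 (D0.f1 x)) (E0.fG H1 H2 m * ((E1.fG H1 H2 m)⁻¹ * E2.fG H1 H2 m)) := by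
    intro x m
    have e1 : D1.f1 x = GN.ga m (D0.f1 x) ↔
        G.faceT R 0 1 x = ((G.g 1).tmA R).gauge m.val (G.faceT R 0 0 x) := by
      rw [Subtype.ext_iff, GN.ga_coe]; rfl
    rw [e1, GN.St, GN.val_mul, GN.val_mul, GN.val_inv]
    exact ⟨fun h => ⟨h.1, h.2.2.1, h.2.2.2⟩, fun h => ⟨h.1, m.val_mem, h.2.1, h.2.2⟩⟩
  have hR : ∀ (x : ((G.g 0).tmA R).comp 1) (m : GN H1) (y : ((G.g 0).tmA R).comp 1) (n : GN H1),
      G.srel R (x, m.val) (y, n.val) ↔ ∃ a : GN H0, GN.ga a x = y ∧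
      GN.St (D0.f1 x) (m⁻¹ * ((D1.fG H0 H1 a)⁻¹ * (n * D0.fG H0 H1 a))) := by
    intro x m y n
    constructor
    · rintro ⟨a, ha, b, hb, h1, h2⟩
      refine ⟨GN.mk H0 a ha, Subtype.ext ((GN.ga_coe _ _).trans h1), ?_⟩
      rw [GN.St, GN.val_mul, GN.val_mul, GN.val_mul, GN.val_inv, GN.val_inv]
      exact ⟨b, hb, h2⟩
    · rintro ⟨a, h1, h2⟩
      rw [GN.St, GN.val_mul, GN.val_mul, GN.val_mul, GN.val_inv, GN.val_inv] at h2
      obtain ⟨b, hb, h2⟩ := h2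
      exact ⟨a.val, a.val_mem, b, hb, (GN.ga_coe _ _).symm.trans (congrArg Subtype.val h1), h2⟩
  obtain ⟨r1, r2, r3, r4⟩ := abs_main H0 H1 H2 D0 D1 E0 E1 E2
    (fun x => faceT_comm G R 0 0 0 le_rfl x) (fun x => faceT_comm G R 0 1 0 (by simp) x)
    (fun x => faceT_comm G R 0 1 1 le_rfl x) _ hZ _ hR
  have lift : ∀ p ∈ G.Zsc R, ∃ (x : ((G.g 0).tmA R).comp 1) (m : GN H1),
      p = ((x : ((G.g 0).tmA R).carrier), m.val) :=
    fun p hp => ⟨⟨p.1, hp.1.1⟩, GN.mk H1 p.2 hp.2.1, rfl⟩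
  refine ⟨?_, ?_, ?_, ?_⟩
  · intro p hp
    obtain ⟨x, m, rfl⟩ := lift p hp
    exact r1 x m hp
  · intro p q hp hq h
    obtain ⟨x, m, rfl⟩ := lift p hp
    obtain ⟨y, n, rfl⟩ := lift q hq
    exact r2 x m y n hp h
  · intro p q r hp hq hr h h'
    obtain ⟨x, m, rfl⟩ := lift p hp
    obtain ⟨y, n, rfl⟩ := lift q hq
    obtain ⟨z, o, rfl⟩ := lift r hr
    exact r3 x m y n z o hp h h'
  · intro p q hp hq1 hq2 h
    obtain ⟨x, m, rfl⟩ := lift p hp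
    exact r4 x m ⟨q.1, hq1⟩ (GN.mk H1 q.2 hq2) hp h
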